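/- arXiv:math/0211420 — 2 statements merged into one kernel-verified Lean document; each statement's English description precedes it below -/
import Mathlib

section
/- Let A be a finite set with |A| ≥ 2 and let F be a set of finitary operations on A such that no relation on A invariant under F belongs to Rosenberg's list. Then the algebra (A,F) has almost minimal spectrum: for every m ≥ 1, every nonempty F-invariant subset B ⊆ A^m has cardinality |B| = |A|^k for some natural number k. -/
/-- An `n`-ary operation on `A`. -/
abbrev Op (A : Type*) (n : ℕ) : Type _ := (Fin n → A) → A

/-- A family of sets of finitary operations is a clone if it contains all projections
and is closed under composition. -/
def IsClone {A : Type*} (C : ∀ n, Set (Op A n)) : Prop :=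
  (∀ (n : ℕ) (i : Fin n), (fun v : Fin n → A => v i) ∈ C n) ∧
  (∀ (n k : ℕ) (f : Op A n) (g : Fin n → Op A k),
    f ∈ C n → (∀ i, g i ∈ C k) → (fun v : Fin k → A => f (fun i => g i v)) ∈ C k)

/-- A clone is maximal if it is proper and any clone containing it is itself or everything. -/
def IsMaximalClone {A : Type*} (C : ∀ n, Set (Op A n)) : Prop :=
  IsClone C ∧ C ≠ (fun _ => Set.univ) ∧
  ∀ D : ∀ n, Set (Op A n), IsClone D → (∀ n, C n ⊆ D n) →
    D = C ∨ D = (fun _ => Set.univ)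

/-- An `n`-ary operation preserves an `h`-ary relation `ρ`. -/
def Preserves {A : Type*} {n h : ℕ} (f : Op A n) (ρ : Set (Fin h → A)) : Prop :=
  ∀ r : Fin n → Fin h → A, (∀ i, r i ∈ ρ) → (fun j : Fin h => f (fun i => r i j)) ∈ ρ

/-- The polymorphism clone of a relation. -/
def Pol {A : Type*} {h : ℕ} (ρ : Set (Fin h → A)) : ∀ n, Set (Op A n) :=
  fun n => {f | Preserves f ρ}

/-- The relation `ι_h^A` of tuples with two equal coordinates. -/
def iotaRel (A : Type*) (h : ℕ) : Set (Fin h → A) :=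
  {v | ∃ i j : Fin h, i ≠ j ∧ v i = v j}

/-- A relation is totally reflexive if it contains `ι_h^A`. -/
def TotallyReflexive {A : Type*} {h : ℕ} (ρ : Set (Fin h → A)) : Prop :=
  iotaRel A h ⊆ ρ

/-- A relation is totally symmetric if it is closed under permutations of coordinates. -/
def TotallySymmetric {A : Type*} {h : ℕ} (ρ : Set (Fin h → A)) : Prop :=
  ∀ (σ : Equiv.Perm (Fin h)) (v : Fin h → A), v ∈ ρ → (fun i => v (σ i)) ∈ ρ

/-- The center of a relation: elements `a` such that every tuple containing `a` is in `ρ`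
(for totally symmetric `ρ` this agrees with the usual definition). -/
def centerRel {A : Type*} {h : ℕ} (ρ : Set (Fin h → A)) : Set A :=
  {a | ∀ v : Fin h → A, (∃ i, v i = a) → v ∈ ρ}

/-- An `h`-ary central relation. -/
def IsCentral {A : Type*} [Fintype A] {h : ℕ} (ρ : Set (Fin h → A)) : Prop :=
  1 ≤ h ∧ h ≤ Fintype.card A ∧ TotallyReflexive ρ ∧ TotallySymmetric ρ ∧
  (centerRel ρ).Nonempty ∧ centerRel ρ ≠ Set.univ

/-- The pair `(a, b)` as a binary tuple. -/
def pair {A : Type*} (a b : A) : Fin 2 → A := ![a, b]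

/-- A bounded partial order: a partial order with a least and a greatest element. -/
def IsBoundedPartialOrder {A : Type*} (ρ : Set (Fin 2 → A)) : Prop :=
  (∀ a : A, pair a a ∈ ρ) ∧
  (∀ a b : A, pair a b ∈ ρ → pair b a ∈ ρ → a = b) ∧
  (∀ a b c : A, pair a b ∈ ρ → pair b c ∈ ρ → pair a c ∈ ρ) ∧
  (∃ z : A, ∀ a : A, pair z a ∈ ρ) ∧
  (∃ o : A, ∀ a : A, pair a o ∈ ρ)

/-- The graph of a prime permutation: a permutation all of whose cycles have the same
prime length `p` (equivalently, `π ^ p = 1` and `π` has no fixed point). -/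
def IsPrimePermGraph {A : Type*} (ρ : Set (Fin 2 → A)) : Prop :=
  ∃ (π : Equiv.Perm A) (p : ℕ), p.Prime ∧ π ^ p = 1 ∧ (∀ a, π a ≠ a) ∧
    ρ = {v | v 1 = π (v 0)}

/-- A nontrivial equivalence relation: different from the diagonal and from everything. -/
def IsNontrivialEquivalence {A : Type*} (ρ : Set (Fin 2 → A)) : Prop :=
  (∀ a : A, pair a a ∈ ρ) ∧
  (∀ a b : A, pair a b ∈ ρ → pair b a ∈ ρ) ∧
  (∀ a b c : A, pair a b ∈ ρ → pair b c ∈ ρ → pair a c ∈ ρ) ∧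
  ρ ≠ {v | v 0 = v 1} ∧ ρ ≠ Set.univ

/-- `n`-fold sum of `a` with respect to a raw addition. -/
def iterAdd {A : Type*} (add : A → A → A) (zero : A) : ℕ → A → A
  | 0, _ => zero
  | n + 1, a => add a (iterAdd add zero n a)

/-- A prime-affine relation: `{(a,b,c,d) : a + b = c + d}` for an abelian group structure
in which every non-identity element has order a fixed prime `p`. -/
def IsPrimeAffine {A : Type*} (ρ : Set (Fin 4 → A)) : Prop :=
  ∃ (add : A → A → A) (zero : A) (p : ℕ),
    p.Prime ∧
    (∀ a b, add a b = add b a) ∧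
    (∀ a b c, add (add a b) c = add a (add b c)) ∧
    (∀ a, add a zero = a) ∧
    (∀ a, ∃ b, add a b = zero) ∧
    (∀ a, iterAdd add zero p a = zero) ∧
    ρ = {v | add (v 0) (v 1) = add (v 2) (v 3)}

/-- The relation `ω_λ` on `h^λ`: in every coordinate the `h` values are not pairwise distinct. -/
def omegaRel (h lam : ℕ) : Set (Fin h → (Fin lam → Fin h)) :=
  {b | ∀ r : Fin lam, ∃ i j : Fin h, i ≠ j ∧ b i r = b j r}

/-- An `h`-regularly generated relation: the preimage of `ω_λ` under a surjection `A → h^λ`. -/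
def IsRegularlyGenerated {A : Type*} [Fintype A] {h : ℕ} (ρ : Set (Fin h → A)) : Prop :=
  3 ≤ h ∧ h ≤ Fintype.card A ∧
  ∃ lam : ℕ, 1 ≤ lam ∧ ∃ φ : A → Fin lam → Fin h,
    Function.Surjective φ ∧
    ρ = {v | (fun i => φ (v i)) ∈ omegaRel h lam}

/-- Rosenberg's list of relations (of varying arities, packaged as a sigma type). -/
def InRosenbergList {A : Type*} [Fintype A] (ρ : Σ h : ℕ, Set (Fin h → A)) : Prop :=
  (∃ r : Set (Fin 2 → A),
      ρ = ⟨2, r⟩ ∧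
        (IsBoundedPartialOrder r ∨ IsPrimePermGraph r ∨ IsNontrivialEquivalence r)) ∨
  (∃ r : Set (Fin 4 → A), ρ = ⟨4, r⟩ ∧ IsPrimeAffine r) ∨
  IsCentral ρ.2 ∨ IsRegularlyGenerated ρ.2

namespace Ros
open Function

section basics

variable {A : Type*} (F : ∀ n, Set (Op A n))

/-- Invariance of a set of tuples indexed by an arbitrary type. -/
def Inv {V : Type*} (ρ : Set (V → A)) : Prop :=
  ∀ n, ∀ f ∈ F n, ∀ r : Fin n → V → A, (∀ i, r i ∈ ρ) → (fun v => f (fun i => r i v)) ∈ ρ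

def Inv1 (s : A → Prop) : Prop :=
  ∀ n, ∀ f ∈ F n, ∀ x : Fin n → A, (∀ i, s (x i)) → s (f x)

def Inv2 (s : A → A → Prop) : Prop :=
  ∀ n, ∀ f ∈ F n, ∀ x y : Fin n → A, (∀ i, s (x i) (y i)) → s (f x) (f y)

def Inv3 (s : A → A → A → Prop) : Prop :=
  ∀ n, ∀ f ∈ F n, ∀ x y z : Fin n → A, (∀ i, s (x i) (y i) (z i)) → s (f x) (f y) (f z)

def Inv4 (s : A → A → A → A → Prop) : Prop :=
  ∀ n, ∀ f ∈ F n, ∀ x y z w : Fin n → A, (∀ i, s (x i) (y i) (z i) (w i)) →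
    s (f x) (f y) (f z) (f w)

/-- The clone generated by `F`, over an arbitrary index type. -/
inductive Clo {I : Type*} : ((I → A) → A) → Prop
  | proj (i : I) : Clo (fun v => v i)
  | app (n : ℕ) (f : Op A n) (hf : f ∈ F n) (g : Fin n → (I → A) → A)
      (hg : ∀ i, Clo (g i)) : Clo (fun v => f (fun i => g i v))

variable {F}

theorem Clo.comp {I J : Type*} {g : (J → A) → A} (hg : Clo F g) (k : J → (I → A) → A)
    (hk : ∀ j, Clo F (k j)) : Clo F (fun v => g (fun j => k j v)) := by
  induction hg with
  | proj i => exact hk i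
  | app n f hf g hg ih => exact Clo.app n f hf (fun i v => g i (fun j => k j v)) ih

theorem Clo.pres {I V : Type*} {g : (I → A) → A} (hg : Clo F g) {ρ : Set (V → A)}
    (hρ : Inv F ρ) (r : I → V → A) (hr : ∀ i, r i ∈ ρ) :
    (fun v => g (fun i => r i v)) ∈ ρ := by
  induction hg with
  | proj i => exact hr i
  | app n f hf g hg ih => exact hρ n f hf _ ih

theorem gen {V : Type*} (Z : Set (V → A)) (t : V → A)
    (h : ∀ ρ : Set (V → A), Inv F ρ → Z ⊆ ρ → t ∈ ρ) :
    ∃ g : (Z → A) → A, Clo F g ∧ t = fun v => g (fun z => z.1 v) := by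
  refine h {t | ∃ g : (Z → A) → A, Clo F g ∧ t = fun v => g (fun z => z.1 v)} ?_ ?_
  · intro n f hf r hr
    choose g hg hgr using hr
    refine ⟨fun v => f (fun i => g i v), Clo.app n f hf g hg, ?_⟩
    funext v
    congr 1
    funext i
    exact congrFun (hgr i) v
  · intro z hz
    exact ⟨fun v => v ⟨z, hz⟩, Clo.proj _, rfl⟩

theorem Inv2.inv {s : A → A → Prop} (h : Inv2 F s) :
    Inv F {v : Fin 2 → A | s (v 0) (v 1)} := fun n f hf r hr => h n f hf _ _ hr

theorem Inv1.inv {s : A → Prop} (h : Inv1 F s) :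
    Inv F {v : Fin 1 → A | s (v 0)} := fun n f hf r hr => h n f hf _ hr

theorem Clo.pres2 {I : Type*} {g : (I → A) → A} (hg : Clo F g) {s : A → A → Prop}
    (hs : Inv2 F s) (x y : I → A) (h : ∀ i, s (x i) (y i)) : s (g x) (g y) := by
  induction hg with
  | proj i => exact h i
  | app n f hf g hg ih => exact hs n f hf _ _ ih

theorem Clo.pres3 {I : Type*} {g : (I → A) → A} (hg : Clo F g) {s : A → A → A → Prop}
    (hs : Inv3 F s) (x y z : I → A) (h : ∀ i, s (x i) (y i) (z i)) : s (g x) (g y) (g z) := by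
  induction hg with
  | proj i => exact h i
  | app n f hf g hg ih => exact hs n f hf _ _ _ ih

theorem Clo.pres4 {I : Type*} {g : (I → A) → A} (hg : Clo F g) {s : A → A → A → A → Prop}
    (hs : Inv4 F s) (x y z w : I → A) (h : ∀ i, s (x i) (y i) (z i) (w i)) :
    s (g x) (g y) (g z) (g w) := by
  induction hg with
  | proj i => exact h i
  | app n f hf g hg ih => exact hs n f hf _ _ _ _ ih

end basics

/-- No invariant relation is in Rosenberg's list. -/
def NoList {A : Type*} [Fintype A] (F : ∀ n, Set (Op A n)) : Prop :=
  ∀ ρ : (Σ h : ℕ, Set (Fin h → A)), (∀ n, ∀ f ∈ F n, Preserves f ρ.2) → ¬ InRosenbergList ρ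

section nolist

variable {A : Type*} [Fintype A] {F : ∀ n, Set (Op A n)}

theorem noCentral {h : ℕ} (hN : NoList F) (ρ : Set (Fin h → A)) (hρ : Inv F ρ) : ¬ IsCentral ρ :=
  fun hc => hN ⟨h, ρ⟩ hρ (Or.inr (Or.inr (Or.inl hc)))

theorem noReg {h : ℕ} (hN : NoList F) (ρ : Set (Fin h → A)) (hρ : Inv F ρ) : ¬ IsRegularlyGenerated ρ :=
  fun hc => hN ⟨h, ρ⟩ hρ (Or.inr (Or.inr (Or.inr hc)))

theorem noAffine (hN : NoList F) (ρ : Set (Fin 4 → A)) (hρ : Inv F ρ) : ¬ IsPrimeAffine ρ :=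
  fun hc => hN ⟨4, ρ⟩ hρ (Or.inr (Or.inl ⟨ρ, rfl, hc⟩))

theorem noBinary (hN : NoList F) (ρ : Set (Fin 2 → A)) (hρ : Inv F ρ) :
    ¬ (IsBoundedPartialOrder ρ ∨ IsPrimePermGraph ρ ∨ IsNontrivialEquivalence ρ) :=
  fun hc => hN ⟨2, ρ⟩ hρ (Or.inl ⟨ρ, rfl, hc⟩)

end nolist

section combin

variable {h : ℕ} {I X : Type*}

def omS (S : Finset I) (b : Fin h → I → Fin h) : Prop :=
  ∀ k ∈ S, ∃ i j, i ≠ j ∧ b i k = b j k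

def HomOn (S : Finset I) (P : Set (Fin h → X)) (q : (I → Fin h) → X) : Prop :=
  ∀ b, omS S b → (fun i => q (b i)) ∈ P

def Homog (P : Set (Fin h → X)) : Prop :=
  ∀ x u, (∀ i, update x i u ∈ P) → x ∈ P

theorem rep_lemma {R : Finset I} {P : Set (Fin h → X)} {q : (I → Fin h) → X}
    (hq : HomOn R P q) (hP : Homog P) (b b' : Fin h → I → Fin h)
    (hb : (fun i => q (b i)) ∉ P)
    (hc : ∀ (T : Finset (Fin h)) (s m : Fin h), m ≠ s →
      omS R (update (fun i => if i ∈ T then b' i else b i) m (b' s))) :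
    (fun i => q (b' i)) ∉ P := by
  have key : ∀ T : Finset (Fin h), (fun i => q (if i ∈ T then b' i else b i)) ∉ P := by
    intro T
    induction T using Finset.induction_on with
    | empty => simpa using hb
    | insert s T hs ih =>
      intro hin
      apply ih
      apply hP _ (q (b' s))
      intro m
      by_cases hm : m = s
      · subst hm
        convert hin using 1
        funext i
        by_cases hi : i = m
        · subst hi; simp
        · simp [hi]
      · have := hq _ (hc T s m hm)
        convert this using 1
        funext i
        by_cases hi : i = m
        · subst hi; simp
        · simp [hi]
  simpa using key Finset.univ

theorem homog_iota (h : ℕ) : Homog (iotaRel (Fin h) h) := by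
  intro x u hx
  by_contra hn
  have hinj : Injective x := by
    intro i j hij
    by_contra hne
    exact hn ⟨i, j, hne, hij⟩
  obtain ⟨j, hj⟩ := (Finite.injective_iff_surjective.1 hinj) u
  have := hx j
  rw [← hj, update_eq_self] at this
  exact hn this

theorem symm_iota (X : Type*) (h : ℕ) : TotallySymmetric (iotaRel X h) := by
  rintro σ v ⟨i, j, hij, hv⟩
  exact ⟨σ.symm i, σ.symm j, fun e => hij (σ.symm.injective e), by simpa using hv⟩

theorem not_iota {X : Type*} {h : ℕ} {v : Fin h → X} : v ∉ iotaRel X h ↔ Injective v := by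
  constructor
  · intro hn i j hij
    by_contra hne
    exact hn ⟨i, j, hne, hij⟩
  · rintro hi ⟨i, j, hij, hv⟩
    exact hij (hi hv)

theorem move_lemma [DecidableEq I] (hh : 0 < h) {R : Finset I} {P : Set (Fin h → X)}
    {q : (I → Fin h) → X}
    (hq : HomOn R P q) (hP : Homog P) (hs : TotallySymmetric P) {k : I}
    (hnk : ¬ HomOn (R.erase k) P q) :
    ∃ z : I → Fin h, (fun i => q (update z k i)) ∉ P := by
  unfold HomOn at hnk
  push Not at hnk
  obtain ⟨b, hb, hqb⟩ := hnk
  have hbk : Injective (fun i => b i k) := by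
    intro i j hij
    by_contra hne
    apply hqb
    apply hq
    intro l hl
    by_cases hlk : l = k
    · subst hlk; exact ⟨i, j, hne, hij⟩
    · exact hb l (Finset.mem_erase.2 ⟨hlk, hl⟩)
  have hz : ∀ l, ∃ z : Fin h, l ∈ R.erase k → ∃ i j, i ≠ j ∧ b i l = z ∧ b j l = z := by
    intro l
    by_cases hl : l ∈ R.erase k
    · obtain ⟨i, j, hij, he⟩ := hb l hl
      exact ⟨b i l, fun _ => ⟨i, j, hij, rfl, he.symm⟩⟩
    · exact ⟨⟨0, hh⟩, fun h' => absurd h' hl⟩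
  choose z hz using hz
  refine ⟨z, ?_⟩
  have h1 := rep_lemma hq hP b (fun i => update z k (b i k)) hqb ?_
  · intro hin
    let σ : Equiv.Perm (Fin h) :=
      Equiv.ofBijective _ (Finite.injective_iff_bijective.1 hbk)
    exact h1 (hs σ _ hin)
  · intro T s m hms l hl
    by_cases hlk : l = k
    · subst hlk
      refine ⟨m, s, hms, ?_⟩
      by_cases hsT : s ∈ T <;> simp [hms.symm, hsT]
    · obtain ⟨i, j, hij, hi, hj⟩ := hz l (Finset.mem_erase.2 ⟨hlk, hl⟩)
      by_cases him : i = m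
      · have hjm : j ≠ m := fun e => hij (him.trans e.symm)
        refine ⟨m, j, hjm.symm, ?_⟩
        by_cases hsT : j ∈ T <;> simp [hjm, hsT, hlk, hj]
      · refine ⟨m, i, fun e => him e.symm, ?_⟩
        by_cases hsT : i ∈ T <;> simp [him, hsT, hlk, hi]

theorem exists_ne_ne (hh : 3 ≤ h) (j : Fin h) : ∃ a b : Fin h, a ≠ b ∧ a ≠ j ∧ b ≠ j := by
  have : 1 < (Finset.univ.erase j).card := by
    rw [Finset.card_erase_of_mem (Finset.mem_univ _), Finset.card_univ, Fintype.card_fin]; omega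
  obtain ⟨a, ha, b, hb, hab⟩ := Finset.one_lt_card.1 this
  exact ⟨a, b, hab, Finset.ne_of_mem_erase ha, Finset.ne_of_mem_erase hb⟩

/-- existence of a minimal set on which `q` is a homomorphism -/
theorem exists_min_hom [DecidableEq I] {P : Set (Fin h → X)} {q : (I → Fin h) → X}
    (R0 : Finset I) (hq : HomOn R0 P q) :
    ∃ S ⊆ R0, HomOn S P q ∧ ∀ k ∈ S, ¬ HomOn (S.erase k) P q := by
  induction R0 using Finset.strongInduction with
  | H R0 ih =>
    by_cases hc : ∃ k ∈ R0, HomOn (R0.erase k) P q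
    · obtain ⟨k, hk, hke⟩ := hc
      obtain ⟨S, hS, h1, h2⟩ := ih _ (Finset.erase_ssubset hk) hke
      exact ⟨S, hS.trans (Finset.erase_subset _ _), h1, h2⟩
    · push Not at hc
      exact ⟨R0, subset_rfl, hq, hc⟩

theorem slup [DecidableEq I] (hh : 3 ≤ h) (R0 : Finset I) (q : (I → Fin h) → Fin h)
    (hq : HomOn R0 (iotaRel (Fin h) h) q) (b : Fin h → I → Fin h)
    (hb : Injective (fun i => q (b i))) :
    ∃ k ∈ R0, ∃ π : Fin h → Fin h, Injective π ∧ ∀ y, q y = π (y k) := by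
  obtain ⟨S, hS, h1, h2⟩ := exists_min_hom R0 hq
  have hne : S.Nonempty := by
    rw [Finset.nonempty_iff_ne_empty]
    rintro rfl
    exact not_iota.2 hb (h1 b (fun k hk => absurd hk (Finset.notMem_empty k)))
  obtain ⟨k, hk⟩ := hne
  obtain ⟨z, hz⟩ := move_lemma (by omega) h1 (homog_iota h) (symm_iota _ _) (h2 k hk)
  rw [not_iota] at hz
  refine ⟨k, hS hk, _, hz, ?_⟩
  intro y
  obtain ⟨j, hj⟩ := (Finite.injective_iff_surjective.1 hz) (q y)
  by_cases hjk : j = y k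
  · rw [← hj, hjk]
  · exfalso
    have h3 := h1 (update (fun i => update z k i) j y) ?_
    · have : (fun i => q (update (fun i => update z k i) j y i)) = fun i => q (update z k i) := by
        funext i
        by_cases hi : i = j
        · subst hi; simpa using hj.symm
        · simp [hi]
      rw [this] at h3
      exact not_iota.2 hz h3
    · intro l hl
      by_cases hlk : l = k
      · subst hlk
        exact ⟨j, y l, hjk, by simp [Ne.symm hjk]⟩
      · obtain ⟨a, b, hab, ha, hb⟩ := exists_ne_ne hh j
        exact ⟨a, b, hab, by simp [ha, hb, hlk]⟩

end combin

section setup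

variable {A : Type*} {F : ∀ n, Set (Op A n)}

def TR {V : Type*} (ρ : Set (V → A)) : Prop := ∀ v, ¬ Injective v → v ∈ ρ

/-- every invariant totally reflexive relation of arity `t` is full -/
def FullAt (F : ∀ n, Set (Op A n)) (t : ℕ) : Prop :=
  ∀ ρ : Set (Fin t → A), Inv F ρ → TR ρ → ∀ v, v ∈ ρ

theorem FullAt.gen {V : Type*} [Fintype V] (hT : FullAt F (Fintype.card V)) (ρ : Set (V → A))
    (h1 : Inv F ρ) (h2 : TR ρ) (v : V → A) : v ∈ ρ := by
  let e := Fintype.equivFin V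
  have := hT {w | w ∘ e ∈ ρ} (fun n f hf r hr => h1 n f hf _ hr)
    (fun w hw => h2 _ (fun hi => hw (fun i j hij => by
      have := @hi (e.symm i) (e.symm j) (by simpa using hij)
      simpa using this))) (v ∘ e.symm)
  have h3 : (v ∘ e.symm) ∘ e = v := by funext i; simp
  change (v ∘ e.symm) ∘ e ∈ ρ at this
  rwa [h3] at this

theorem TR.tr {h : ℕ} {ρ : Set (Fin h → A)} (hρ : TR ρ) : TotallyReflexive ρ := by
  rintro v ⟨i, j, hij, hv⟩
  exact hρ v (fun hi => hij (hi hv))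

theorem few_full {V : Type*} [Fintype V] [DecidableEq A] (h : ℕ) (hT : ∀ t > h, FullAt F t)
    (ρ : Set (V → A)) (h1 : Inv F ρ)
    (h2 : ∀ x : V → A, (Finset.univ.image x).card ≤ h → x ∈ ρ) (x : V → A) : x ∈ ρ := by
  induction hn : (Finset.univ.image x).card using Nat.strong_induction_on generalizing x with
  | _ n ih =>
    by_cases hc : n ≤ h
    · exact h2 x (hn ▸ hc)
    · push Not at hc
      let Y : Finset A := Finset.univ.image x
      let xh : V → ↥Y := fun v => ⟨x v, Finset.mem_image_of_mem _ (Finset.mem_univ _)⟩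
      have hW : Fintype.card ↥Y = n := by rw [Fintype.card_coe, hn]
      have := FullAt.gen (F := F) (V := ↥Y) (by rw [hW]; exact hT n hc) {y | y ∘ xh ∈ ρ}
        (fun n f hf r hr => h1 n f hf _ hr) ?_ Subtype.val
      · exact this
      · intro y hy
        refine ih _ ?_ (y ∘ xh) rfl
        have h3 : (Finset.univ.image (y ∘ xh)).card ≤ (Finset.univ.image y).card := by
          apply Finset.card_le_card
          intro a ha
          simp only [Finset.mem_image, Finset.mem_univ, true_and] at ha ⊢
          obtain ⟨v, hv⟩ := ha
          exact ⟨xh v, hv⟩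
        have h4 : (Finset.univ.image y).card < Fintype.card ↥Y := by
          refine lt_of_le_of_ne Finset.card_image_le ?_
          intro he
          exact hy (fun a b hab => Finset.card_image_iff.1 he (Finset.mem_coe.2 (Finset.mem_univ a))
            (Finset.mem_coe.2 (Finset.mem_univ b)) hab)
        omega

theorem upd_app {V : Type*} [DecidableEq V] {n : ℕ} (f : Op A n) (r : Fin n → V → A) (m : V)
    (u : Fin n → A) : update (fun v => f (fun i => r i v)) m (f u) =
      fun v => f (fun i => update (r i) m (u i) v) := by
  funext v
  by_cases hv : v = m
  · subst hv; simp
  · simp [hv]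

theorem upd_ninj {V : Type*} [DecidableEq V] (x : V → A) {m i : V} (h : m ≠ i) :
    ¬ Injective (update x m (x i)) := by
  intro hi
  exact h (hi (by simp [h.symm]))

theorem symmetrize_inv {h : ℕ} {ρ : Set (Fin h → A)} (hρ : Inv F ρ) :
    Inv F {v : Fin h → A | ∀ σ : Equiv.Perm (Fin h), v ∘ σ ∈ ρ} :=
  fun n f hf r hr σ => hρ n f hf (fun i => r i ∘ σ) (fun i => hr i σ)

theorem symmetrize_symm {h : ℕ} (ρ : Set (Fin h → A)) :
    TotallySymmetric {v : Fin h → A | ∀ σ : Equiv.Perm (Fin h), v ∘ σ ∈ ρ} := by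
  intro σ v hv τ
  exact hv (τ.trans σ)

theorem symmetrize_TR {h : ℕ} {ρ : Set (Fin h → A)} (hρ : TR ρ) :
    TR {v : Fin h → A | ∀ σ : Equiv.Perm (Fin h), v ∘ σ ∈ ρ} := by
  intro v hv σ
  apply hρ
  intro hi
  apply hv
  have := hi.comp σ.symm.injective
  rwa [Function.comp_assoc, Equiv.self_comp_symm, Function.comp_id] at this

def MaxP (F : ∀ n, Set (Op A n)) {h : ℕ} (P : Set (Fin h → A)) : Prop :=
  ∀ Q : Set (Fin h → A), Inv F Q → TotallySymmetric Q → P ⊆ Q → (∃ x ∈ Q, x ∉ P) → ∀ v, v ∈ Q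

theorem homog_of_max [Fintype A] (hN : NoList F) {h : ℕ} (hh : 0 < h)
    (hT : ∀ t > h, FullAt F t) (P : Set (Fin h → A)) (hP : Inv F P) (hTR : TR P)
    (hTS : TotallySymmetric P) (hmax : MaxP F P) (hnf : ∃ v, v ∉ P) : Homog P := by
  classical
  intro x0 u0 hx0
  by_contra hx0P
  have hfull := hmax {x | ∃ u, ∀ i, update x i u ∈ P} ?_ ?_ ?_ ⟨x0, ⟨u0, hx0⟩, hx0P⟩
  · -- central
    have hcen : (id : A → A) ∈ {y : A → A | ∃ u, ∀ e : Fin h → A, ∀ i, update (y ∘ e) i u ∈ P} := by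
      refine few_full (F := F) h hT _ ?_ ?_ id
      · intro n f hf r hr
        choose u hu using hr
        refine ⟨f u, fun e i => ?_⟩
        have := hP n f hf (fun j => update (r j ∘ e) i (u j)) (fun j => hu j e i)
        rw [← upd_app] at this
        exact this
      · intro y hy
        have hne : Nonempty A := ⟨u0⟩
        -- tuple with range containing image
        obtain ⟨x, hx⟩ : ∃ x : Fin h → A, ∀ a, ∃ i, x i = y a := by
          let Y := Finset.univ.image y
          have : Fintype.card Y ≤ Fintype.card (Fin h) := by
            rw [Fintype.card_coe, Fintype.card_fin]; exact hy
          obtain ⟨g⟩ := Function.Embedding.nonempty_of_card_le this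
          refine ⟨fun i => if hi : ∃ b : Y, g b = i then (hi.choose : A) else Classical.choice hne,
            fun a => ?_⟩
          let b : Y := ⟨y a, Finset.mem_image_of_mem _ (Finset.mem_univ _)⟩
          refine ⟨g b, ?_⟩
          have hb : ∃ c : Y, g c = g b := ⟨b, rfl⟩
          beta_reduce
          rw [dif_pos hb, g.injective hb.choose_spec]
        obtain ⟨u, hu⟩ := hfull x
        refine ⟨u, fun e i => ?_⟩
        choose al hal using fun j => hx (e j)
        by_cases hinj : ∃ j j', j ≠ j' ∧ j ≠ i ∧ j' ≠ i ∧ y (e j) = y (e j')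
        · obtain ⟨j, j', hjj, hj, hj', he⟩ := hinj
          apply hTR
          intro hi
          exact hjj (hi (by simpa [hj, hj'] using he))
        · push Not at hinj
          have : ∃ i', ∀ j, j ≠ i → al j ≠ i' := by
            have hc : ((Finset.univ.erase i).image al).card < Fintype.card (Fin h) := by
              refine lt_of_le_of_lt Finset.card_image_le ?_
              exact Finset.card_lt_univ_of_notMem (Finset.notMem_erase i _)
            obtain ⟨i', hi'⟩ : ∃ i', i' ∉ (Finset.univ.erase i).image al := by
              by_contra hcon
              push Not at hcon
              have := Finset.eq_univ_of_forall hcon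
              rw [this] at hc
              simp at hc
            refine ⟨i', fun j hj hji => hi' ?_⟩
            exact Finset.mem_image.2 ⟨j, Finset.mem_erase.2 ⟨hj, Finset.mem_univ _⟩, hji⟩
          obtain ⟨i', hi'⟩ := this
          have hσ : Injective (update al i i') := by
            intro a b hab
            by_cases ha : a = i
            · by_cases hb : b = i
              · rw [ha, hb]
              · exfalso; subst ha
                simp [hb] at hab
                exact hi' b hb hab.symm
            · by_cases hb : b = i
              · exfalso; subst hb
                simp [ha] at hab
                exact hi' a ha hab
              · simp [ha, hb] at hab
                by_contra hne'
                exact hinj a b hne' ha hb (by rw [← hal, ← hal, hab])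
          let σ : Equiv.Perm (Fin h) := Equiv.ofBijective _ (Finite.injective_iff_bijective.1 hσ)
          have := hTS σ _ (hu i')
          convert this using 1
          funext j
          change _ = update x i' u (update al i i' j)
          by_cases hj : j = i
          · subst hj; simp
          · simp [hj, hi' j hj, hal]
    obtain ⟨u, hu⟩ := hcen
    apply noCentral hN P hP
    obtain ⟨v, hv⟩ := hnf
    refine ⟨hh, ?_, hTR.tr, hTS, ⟨u, ?_⟩, ?_⟩
    · have hvi : Injective v := by
        by_contra hvi
        exact hv (hTR v hvi)
      simpa using Fintype.card_le_of_injective v hvi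
    · rintro w ⟨i, hi⟩
      have := hu w i
      rw [← hi] at this
      simpa using this
    · intro hun
      have : v ⟨0, hh⟩ ∈ centerRel P := by rw [hun]; trivial
      exact hv (this v ⟨_, rfl⟩)
  · intro n f hf r hr
    choose u hu using hr
    refine ⟨f u, fun i => ?_⟩
    rw [upd_app]
    exact hP n f hf _ (fun j => hu j i)
  · rintro σ v ⟨u, hu⟩
    refine ⟨u, fun i => ?_⟩
    have := hTS σ _ (hu (σ i))
    convert this using 1
    funext j
    by_cases hj : j = i
    · subst hj; simp
    · have : σ j ≠ σ i := fun e => hj (σ.injective e)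
      simp [hj]
  · intro x hx
    refine ⟨x ⟨0, hh⟩, fun i => ?_⟩
    by_cases hi : i = ⟨0, hh⟩
    · subst hi; simpa using hx
    · exact hTR _ (upd_ninj x hi)

end setup

section regular

variable {A I : Type*} {F : ∀ n, Set (Op A n)} {h : ℕ}

def fp (f : (I → A) → A) (p : I → Fin h → A) (y : I → Fin h) : A := f (fun k => p k (y k))

structure Ctx [DecidableEq I] (F : ∀ n, Set (Op A n)) (P : Set (Fin h → A)) (f : (I → A) → A)
    (p : I → Fin h → A) (θ : I → A → Fin h) (R : Finset I) : Prop where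
  hh : 3 ≤ h
  hP : Inv F P
  hTR : TR P
  hTS : TotallySymmetric P
  hom : Homog P
  hf : Clo F f
  hfp : ∀ x, fp f p (fun k => θ k x) = x
  hR : HomOn R P (fp f p)
  hmin : ∀ k ∈ R, ¬ HomOn (R.erase k) P (fp f p)

variable [DecidableEq I] {P : Set (Fin h → A)} {f : (I → A) → A}
    {p : I → Fin h → A} {θ : I → A → Fin h} {R : Finset I}

theorem Ctx.move (c : Ctx F P f p θ R) {k : I} (hk : k ∈ R) :
    ∃ z : I → Fin h, (fun i => fp f p (update z k i)) ∉ P := by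
  have := c.hh
  exact move_lemma (by omega) c.hR c.hom c.hTS (c.hmin k hk)

theorem Ctx.ninj (c : Ctx F P f p θ R) {x : Fin h → A} {i j : Fin h} (hij : i ≠ j)
    (hx : x i = x j) : x ∈ P :=
  c.hTR x (fun hi => hij (hi hx))

theorem Ctx.lemL (c : Ctx F P f p θ R) {l : I} (hl : l ∈ R) (x : I → A) (i : Fin h)
    (hx : x l = p l i) : θ l (f x) = i := by
  obtain ⟨z, hz⟩ := c.move hl
  have key : ∀ (y : I → A) (j : Fin h), y l = p l j → ∀ m, m ≠ j →
      update (fun i => fp f p (update z l i)) m (f y) ∈ P := by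
    intro y j hy m hm
    have h1 := c.hf.pres c.hP (fun k i => update (fun i => p k (update z l i k)) m (y k) i) ?_
    · convert h1 using 1
      funext i
      by_cases hi : i = m
      · subst hi; simp
      · simp [hi, fp]
    · intro k
      by_cases hkl : k = l
      · subst hkl
        exact c.ninj hm (by simp [hm.symm, hy])
      · obtain ⟨a, b, hab, ha, hb⟩ := exists_ne_ne c.hh m
        exact c.ninj hab (by simp [ha, hb, hkl])
  by_contra hne
  apply hz
  apply c.hom _ (f x)
  intro m
  by_cases hm : m = i
  · subst hm
    have := key (fun k => p k (θ k (f x))) (θ l (f x)) rfl m (Ne.symm hne)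
    have h2 : f (fun k => p k (θ k (f x))) = f x := c.hfp (f x)
    rwa [h2] at this
  · exact key x i hx m hm

theorem Ctx.fwd (c : Ctx F P f p θ R) (e : Fin h → A)
    (he : ∀ k ∈ R, ∃ i j, i ≠ j ∧ θ k (e i) = θ k (e j)) : e ∈ P := by
  have := c.hR (fun i k => θ k (e i)) he
  simpa only [c.hfp] using this

/-- compatibility of a coordinate -/
def Compat (P : Set (Fin h → A)) (θ : A → Fin h) : Prop :=
  ∀ e ∈ P, ¬ Injective (fun i => θ (e i))

theorem Ctx.step3 (c : Ctx F P f p θ R) {k : I} (hk : k ∈ R) :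
    ∃ k1 ∈ R, Compat P (θ k1) := by
  obtain ⟨z, hz⟩ := c.move hk
  have hh := c.hh
  let β : A → A := fun x => f (update (fun l => p l (z l)) k x)
  let ψ : A → Fin h := fun x => θ k (β x)
  have hψ : ∀ i, ψ (p k i) = i := fun i => c.lemL hk _ i (by simp)
  have hβl : ∀ x, ∀ l ∈ R, l ≠ k → θ l (β x) = z l := fun x l hl hlk =>
    c.lemL hl _ _ (by simp [hlk])
  have hβ : ∀ e ∈ P, (fun i => β (e i)) ∈ P := by
    intro e he
    refine c.hf.pres c.hP (fun l i => update (fun l => p l (z l)) k (e i) l) ?_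
    intro l
    by_cases hl : l = k
    · subst hl; simpa using he
    · exact c.ninj (i := ⟨0, by omega⟩) (j := ⟨1, by omega⟩) (by simp) (by simp [hl])
  have hψP : Compat P ψ := by
    intro e he hinj
    have h0 : (fun i => fp f p (update z k (ψ (e i)))) ∉ P := by
      intro hin
      let σ : Equiv.Perm (Fin h) := Equiv.ofBijective _ (Finite.injective_iff_bijective.1 hinj)
      have := c.hTS σ.symm _ hin
      apply hz
      convert this using 1
      funext i
      have : ψ (e (σ.symm i)) = i := σ.apply_symm_apply i
      rw [this]
    refine rep_lemma c.hR c.hom (fun i => update z k (ψ (e i))) (fun i l => θ l (β (e i))) h0 ?_ ?_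
    · intro T s m hms l hl
      refine ⟨m, s, hms, ?_⟩
      by_cases hlk : l = k
      · subst hlk
        by_cases hsT : s ∈ T <;> simp [hms.symm, hsT, ψ]
      · by_cases hsT : s ∈ T <;> simp [hms.symm, hsT, hlk, hβl _ l hl hlk]
    · have := hβ e he
      simpa only [c.hfp] using this
  obtain ⟨k1, hk1, π, hπ, hq⟩ := slup hh R (fun y => ψ (fp f p y))
    (by
      intro b hb
      by_contra hn
      exact hψP _ (c.hR b hb) (not_iota.1 hn))
    (fun i l => θ l (p k i))
    (by
      simp only [c.hfp, hψ]
      exact fun _ _ h => h)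
  refine ⟨k1, hk1, ?_⟩
  intro e he hinj
  apply hψP e he
  have : (fun i => ψ (e i)) = fun i => π (θ k1 (e i)) := by
    funext i
    have := hq (fun l => θ l (e i))
    simpa only [c.hfp] using this
  rw [this]
  exact hπ.comp hinj

theorem Ctx.step4 [Finite A] (c : Ctx F P f p θ R) (hmax : MaxP F P) {k : I} (hk : k ∈ R) :
    Compat P (θ k) := by
  classical
  obtain ⟨k1, hk1, hcomp⟩ := c.step3 hk
  obtain ⟨z, hz⟩ := c.move hk
  have hh := c.hh
  let a : Fin h → A := fun i => fp f p (update z k i)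
  have ha : a ∉ P := hz
  have hal : ∀ l ∈ R, l ≠ k → ∀ i, θ l (a i) = z l := fun l hl hlk i =>
    c.lemL hl _ _ (by simp [hlk])
  let Z : Set (Fin h → A) := P ∪ {v | ∃ σ : Equiv.Perm (Fin h), v = a ∘ σ}
  let w : Fin h → A := fun i => fp f p (fun _ => i)
  have hw : ∀ i, θ k1 (w i) = i := fun i => c.lemL hk1 _ _ rfl
  obtain ⟨g, hg, hgw⟩ := gen (F := F) Z w (by
    intro ρ hρ hZ
    have := hmax _ (symmetrize_inv hρ) (symmetrize_symm ρ)
      (fun v hv σ => hZ (Or.inl (c.hTS σ v hv)))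
      ⟨a, fun σ => hZ (Or.inr ⟨σ, rfl⟩), ha⟩ w
    exact this (Equiv.refl _))
  have hgw' : ∀ i, g (fun ζ => ζ.1 i) = w i := fun i => (congrFun hgw i).symm
  have : Fintype Z := Fintype.ofFinite Z
  obtain ⟨⟨ζ0, l0⟩, hl0, π, hπ, hq⟩ := slup hh ((Finset.univ : Finset Z) ×ˢ R)
    (fun y => θ k1 (g (fun ζ => fp f p (fun l => y (ζ, l)))))
    (by
      intro b hb
      by_contra hn
      refine hcomp _ ?_ (not_iota.1 hn)
      refine hg.pres c.hP (fun ζ i => fp f p (fun l => b i (ζ, l))) ?_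
      intro ζ
      refine c.hR (fun i l => b i (ζ, l)) ?_
      intro l hl
      exact hb (ζ, l) (Finset.mem_product.2 ⟨Finset.mem_univ _, hl⟩))
    (fun i ζl => θ ζl.2 (ζl.1.1 i))
    (by
      simp only [c.hfp, hgw', hw]
      exact fun _ _ h => h)
  have hl0R : l0 ∈ R := (Finset.mem_product.1 hl0).2
  have hq' : ∀ u : Z → A, θ k1 (g u) = π (θ l0 (u ζ0)) := by
    intro u
    have := hq (fun ζl => θ ζl.2 (u ζl.1))
    simpa only [c.hfp] using this
  have hcl0 : Compat P (θ l0) := by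
    intro e he hinj
    refine hcomp _ (hg.pres c.hP (fun _ => e) (fun _ => he)) ?_
    simp only [hq']
    exact hπ.comp hinj
  have hζ : Injective (fun i => θ l0 (ζ0.1 i)) := by
    intro i j hij
    have h1 := hq' (fun ζ => ζ.1 i)
    have h2 := hq' (fun ζ => ζ.1 j)
    rw [hgw', hw] at h1 h2
    rw [h1, h2]
    exact congrArg π hij
  have hζP : ζ0.1 ∉ P := fun hin => hcl0 _ hin hζ
  obtain ⟨σ, hσ⟩ := ζ0.2.resolve_left hζP
  by_cases hlk : l0 = k
  · rw [← hlk]; exact hcl0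
  · exfalso
    have : (⟨0, by omega⟩ : Fin h) = ⟨1, by omega⟩ := by
      apply hζ
      simp only [hσ, Function.comp]
      rw [hal l0 hl0R hlk, hal l0 hl0R hlk]
    simp at this

theorem Ctx.final [Fintype A] (c : Ctx F P f p θ R) (hmax : MaxP F P) (hnf : ∃ v, v ∉ P) :
    IsRegularlyGenerated P := by
  have hh := c.hh
  obtain ⟨v, hv⟩ := hnf
  have hiff : ∀ e, e ∈ P ↔ ∀ k ∈ R, ∃ i j, i ≠ j ∧ θ k (e i) = θ k (e j) := by
    intro e
    refine ⟨fun he k hk => ?_, c.fwd e⟩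
    have := c.step4 hmax hk e he
    by_contra hn
    exact this (not_iota.1 hn)
  refine ⟨hh, ?_, R.card, ?_, fun x r => θ (R.equivFin.symm r).1 x, ?_, ?_⟩
  · have hvi : Injective v := by
      by_contra hvi
      exact hv (c.hTR v hvi)
    simpa using Fintype.card_le_of_injective v hvi
  · rw [Nat.one_le_iff_ne_zero, Finset.card_ne_zero, Finset.nonempty_iff_ne_empty]
    rintro rfl
    exact hv ((hiff v).2 (fun k hk => absurd hk (Finset.notMem_empty k)))
  · intro y
    refine ⟨fp f p (fun k => if hk : k ∈ R then y (R.equivFin ⟨k, hk⟩) else ⟨0, by omega⟩), ?_⟩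
    funext r
    refine c.lemL (R.equivFin.symm r).2 _ _ ?_
    simp
  · ext e
    rw [hiff]
    constructor
    · intro he r
      exact he _ (R.equivFin.symm r).2
    · intro he k hk
      have := he (R.equivFin ⟨k, hk⟩)
      simpa using this

theorem cover [Fintype A] [DecidableEq A] [Nonempty A] (hh : 0 < h) (y : A → A)
    (hy : (Finset.univ.image y).card ≤ h) :
    ∃ (x : Fin h → A) (t : A → Fin h), ∀ a, x (t a) = y a := by
  let Y := Finset.univ.image y
  have : Fintype.card Y ≤ Fintype.card (Fin h) := by
    rw [Fintype.card_coe, Fintype.card_fin]; exact hy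
  obtain ⟨g⟩ := Function.Embedding.nonempty_of_card_le this
  let b : A → Y := fun a => ⟨y a, Finset.mem_image_of_mem _ (Finset.mem_univ _)⟩
  have : Nonempty Y := ⟨b (Classical.arbitrary A)⟩
  exact ⟨fun i => (invFun g i).1, fun a => g (b a), fun a => by
    beta_reduce; rw [leftInverse_invFun g.injective]⟩

theorem no_max [Fintype A] (hN : NoList F) (hh : 3 ≤ h)
    (hT : ∀ t > h, FullAt F t) (P : Set (Fin h → A)) (hP : Inv F P) (hTR : TR P)
    (hTS : TotallySymmetric P) (hmax : MaxP F P) (hnf : ∃ v, v ∉ P) : False := by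
  classical
  have hom := homog_of_max hN (by omega) hT P hP hTR hTS hmax hnf
  let Z : Set (A → A) := {g | (Finset.univ.image g).card ≤ h}
  obtain ⟨f, hf, hfid⟩ := gen (F := F) Z id (fun ρ hρ hZ => few_full h hT ρ hρ hZ id)
  obtain ⟨v, hv⟩ := hnf
  have : Nonempty A := ⟨v ⟨0, by omega⟩⟩
  choose p θ hpθ using fun z : Z => cover (by omega) z.1 z.2
  have : Fintype Z := Fintype.ofFinite Z
  have hfp : ∀ x, fp f p (fun k => θ k x) = x := by
    intro x
    have := congrFun hfid x
    simp only [id] at this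
    simp only [fp, hpθ]
    exact this.symm
  have hu : HomOn (Finset.univ : Finset Z) P (fp f p) := by
    intro b hb
    refine hf.pres hP (fun k i => p k (b i k)) ?_
    intro k
    obtain ⟨i, j, hij, he⟩ := hb k (Finset.mem_univ _)
    exact hTR _ (fun hi => hij (hi (by simp only [he])))
  obtain ⟨R, -, h1, h2⟩ := exists_min_hom _ hu
  have c : Ctx F P f p θ R := ⟨hh, hP, hTR, hTS, hom, hf, hfp, h1, h2⟩
  exact noReg hN P hP (c.final hmax ⟨v, hv⟩)

theorem fullAt_of_card_lt [Fintype A] {t : ℕ} (ht : Fintype.card A < t) : FullAt F t := by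
  intro ρ _ h2 v
  apply h2
  intro hi
  have := Fintype.card_le_of_injective v hi
  simp at this
  omega

/-- Statement (T). -/
theorem fullAt [Fintype A] (hN : NoList F) : ∀ t, 3 ≤ t → FullAt F t := by
  classical
  have key : ∀ d t, 3 ≤ t → Fintype.card A < t + d → FullAt F t := by
    intro d
    induction d with
    | zero => intro t _ ht; exact fullAt_of_card_lt ht
    | succ d ih =>
      intro t ht hd
      have hT : ∀ s > t, FullAt F s := fun s hs => ih s (by omega) (by omega)
      by_contra hnot
      unfold FullAt at hnot
      push Not at hnot
      obtain ⟨ρ, hρ, hρT, v, hv⟩ := hnot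
      -- the set of candidates
      let C : Set (Set (Fin t → A)) :=
        {Q | Inv F Q ∧ TR Q ∧ TotallySymmetric Q ∧ ∃ v, v ∉ Q}
      have hC : C.Nonempty := ⟨{v | ∀ σ : Equiv.Perm (Fin t), v ∘ σ ∈ ρ}, symmetrize_inv hρ,
        symmetrize_TR hρT, symmetrize_symm ρ, v, fun hin => hv (hin (Equiv.refl _))⟩
      obtain ⟨P, hPC, hPmax⟩ := Set.Finite.exists_maximal (Set.toFinite C) hC
      refine no_max hN ht hT P hPC.1 hPC.2.1 hPC.2.2.1 ?_ hPC.2.2.2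
      rintro Q hQ hQS hPQ ⟨x, hxQ, hxP⟩
      by_contra hn
      push Not at hn
      have : Q ∈ C := ⟨hQ, fun v hv => hPQ (hPC.2.1 v hv), hQS, hn⟩
      exact hxP (hPmax this hPQ hxQ)
  intro t ht
  exact key (Fintype.card A + 1) t ht (by omega)

end regular

section binary

variable {A : Type*} {F : ∀ n, Set (Op A n)}

theorem two_vals {V : Type*} [Fintype V] [DecidableEq A] [Nonempty A] (x : V → A)
    (hx : (Finset.univ.image x).card ≤ 2) : ∃ c d, ∀ v, x v = c ∨ x v = d := by
  obtain ⟨c, d, hcd⟩ : ∃ c d, Finset.univ.image x ⊆ {c, d} := by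
    have h3 : (Finset.univ.image x).card = 0 ∨ (Finset.univ.image x).card = 1 ∨
      (Finset.univ.image x).card = 2 := by omega
    rcases h3 with h | h | h
    · rw [Finset.card_eq_zero] at h
      exact ⟨Classical.arbitrary A, Classical.arbitrary A, by rw [h]; exact Finset.empty_subset _⟩
    · obtain ⟨c, hc⟩ := Finset.card_eq_one.1 h
      exact ⟨c, c, by rw [hc]; simp⟩
    · obtain ⟨c, d, _, hc⟩ := Finset.card_eq_two.1 h
      exact ⟨c, d, by rw [hc]⟩
  refine ⟨c, d, fun v => ?_⟩
  have := hcd (Finset.mem_image_of_mem x (Finset.mem_univ v))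
  simpa using this

/-- relations containing all tuples with at most two values are full -/
theorem D2 [Fintype A] [Nonempty A] (hN : NoList F) {V : Type*} [Fintype V] (ρ : Set (V → A))
    (h1 : Inv F ρ) (h2 : ∀ (x : V → A) (c d : A), (∀ v, x v = c ∨ x v = d) → x ∈ ρ)
    (x : V → A) : x ∈ ρ := by
  classical
  refine few_full 2 (fun t ht => fullAt hN t ht) ρ h1 ?_ x
  intro y hy
  obtain ⟨c, d, hcd⟩ := two_vals y hy
  exact h2 y c d hcd

theorem common [Fintype A] [Nonempty A] (hN : NoList F) {W : Type*} (s : (W → A) → A → Prop)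
    (hs : ∀ n, ∀ f ∈ F n, ∀ (x : Fin n → W → A) (y : Fin n → A), (∀ i, s (x i) (y i)) →
      s (fun w => f (fun i => x i w)) (f y))
    (h : ∀ y y', ∃ x, s x y ∧ s x y') : ∃ x, ∀ y, s x y := by
  refine D2 hN {y : A → A | ∃ x, ∀ a, s x (y a)} ?_ ?_ id
  · intro n f hf r hr
    choose x hx using hr
    exact ⟨_, fun a => hs n f hf x (fun i => r i a) (fun i => hx i a)⟩
  · intro y c d hy
    obtain ⟨x, hc, hd⟩ := h c d
    refine ⟨x, fun a => ?_⟩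
    rcases hy a with e | e <;> rw [e] <;> assumption

theorem common1 [Fintype A] [Nonempty A] (hN : NoList F) (s : A → A → Prop)
    (hs : Inv2 F s) (h : ∀ y y', ∃ x, s x y ∧ s x y') : ∃ x, ∀ y, s x y := by
  obtain ⟨x, hx⟩ := common hN (W := Unit) (fun x y => s (x ()) y)
    (fun n f hf x y hxy => hs n f hf _ _ hxy)
    (fun y y' => by obtain ⟨x, hx⟩ := h y y'; exact ⟨fun _ => x, hx⟩)
  exact ⟨_, hx⟩

theorem common2 [Fintype A] [Nonempty A] (hN : NoList F) (s : A → A → A → Prop)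
    (hs : Inv3 F s) (h : ∀ y y', ∃ a b, s a b y ∧ s a b y') : ∃ a b, ∀ y, s a b y := by
  obtain ⟨x, hx⟩ := common hN (W := Fin 2) (fun x y => s (x 0) (x 1) y)
    (fun n f hf x y hxy => hs n f hf _ _ _ hxy)
    (fun y y' => by obtain ⟨a, b, hx⟩ := h y y'; exact ⟨![a, b], hx⟩)
  exact ⟨_, _, hx⟩

theorem common3 [Fintype A] [Nonempty A] (hN : NoList F) (s : A → A → A → A → Prop)
    (hs : Inv4 F s) (h : ∀ y y', ∃ a b c, s a b c y ∧ s a b c y') :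
    ∃ a b c, ∀ y, s a b c y := by
  obtain ⟨x, hx⟩ := common hN (W := Fin 3) (fun x y => s (x 0) (x 1) (x 2) y)
    (fun n f hf x y hxy => hs n f hf _ _ _ _ hxy)
    (fun y y' => by obtain ⟨a, b, c, hx⟩ := h y y'; exact ⟨![a, b, c], hx⟩)
  exact ⟨_, _, _, hx⟩

theorem unary_full [Fintype A] (hN : NoList F) (s : A → Prop) (hs : Inv1 F s)
    (hne : ∃ a, s a) : ∀ a, s a := by
  by_contra hn
  push Not at hn
  obtain ⟨b, hb⟩ := hn
  obtain ⟨a, ha⟩ := hne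
  refine noCentral hN _ hs.inv ⟨le_rfl, ?_, ?_, ?_, ⟨a, ?_⟩, ?_⟩
  · exact Fintype.card_pos_iff.2 ⟨a⟩
  · rintro v ⟨i, j, hij, _⟩
    exact absurd (Subsingleton.elim i j) hij
  · intro σ v hv
    change s (v (σ 0))
    rw [Subsingleton.elim (σ 0) 0]; exact hv
  · rintro v ⟨i, hi⟩
    change s (v 0)
    rw [Subsingleton.elim 0 i, hi]; exact ha
  · intro hun
    have : b ∈ centerRel {v : Fin 1 → A | s (v 0)} := by rw [hun]; trivial
    exact hb (this (fun _ => b) ⟨0, rfl⟩)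

theorem comp_inv {r s : A → A → Prop} (hr : Inv2 F r) (hs : Inv2 F s) :
    Inv2 F (fun x z => ∃ y, r x y ∧ s y z) := by
  intro n f hf x z h
  choose y hy using h
  exact ⟨f y, hr n f hf _ _ (fun i => (hy i).1), hs n f hf _ _ (fun i => (hy i).2)⟩

theorem swap_inv {r : A → A → Prop} (hr : Inv2 F r) : Inv2 F (fun x y => r y x) :=
  fun n f hf x y h => hr n f hf y x h

theorem symm_case [Fintype A] (hA : 2 ≤ Fintype.card A) (hN : NoList F) (r0 : A → A → Prop)
    (h0 : Inv2 F r0) (hrefl : ∀ x, r0 x x) (hsymm : ∀ x y, r0 x y → r0 y x)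
    (hnd : ∃ x y, x ≠ y ∧ r0 x y) : ∀ x y, r0 x y := by
  by_contra hnf
  push Not at hnf
  have : Nonempty A := ⟨hnf.choose⟩
  let C : Set (A → A → Prop) := {r | Inv2 F r ∧ (∀ x, r x x) ∧ (∀ x y, r x y → r y x) ∧
    (∃ x y, x ≠ y ∧ r x y) ∧ ∃ x y, ¬ r x y}
  obtain ⟨r, hrC, hmax⟩ := Set.Finite.exists_maximal (Set.toFinite C)
    ⟨r0, h0, hrefl, hsymm, hnd, hnf⟩
  obtain ⟨hr, hre, hsy, hnd, hnf⟩ := hrC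
  by_cases hfull : ∀ x z, ∃ y, r x y ∧ r y z
  · obtain ⟨u, hu⟩ := common1 hN r hr (fun y y' => by
      obtain ⟨x, h1, h2⟩ := hfull y y'
      exact ⟨x, hsy _ _ h1, h2⟩)
    refine noCentral hN _ hr.inv ⟨by norm_num, hA, ?_, ?_, ⟨u, ?_⟩, ?_⟩
    · rintro v ⟨i, j, hij, hv⟩
      change r (v 0) (v 1)
      have : v 0 = v 1 := by
        fin_cases i <;> fin_cases j <;> simp_all
      rw [this]; exact hre _
    · intro σ v hv
      change r (v (σ 0)) (v (σ 1))
      have hne : σ 0 ≠ σ 1 := fun e => by simpa using σ.injective e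
      have h2 : ∀ a b : Fin 2, a ≠ b → r (v a) (v b) := by
        intro a b hab
        fin_cases a <;> fin_cases b
        · simp at hab
        · exact hv
        · exact hsy _ _ hv
        · simp at hab
      exact h2 _ _ hne
    · rintro v ⟨i, hi⟩
      change r (v 0) (v 1)
      fin_cases i
      · change v 0 = u at hi; rw [hi]; exact hu _
      · change v 1 = u at hi; rw [hi]; exact hsy _ _ (hu _)
    · intro hun
      obtain ⟨x, y, hxy⟩ := hnf
      have : x ∈ centerRel {v : Fin 2 → A | r (v 0) (v 1)} := by rw [hun]; trivial
      exact hxy (this ![x, y] ⟨0, rfl⟩)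
  · push Not at hfull
    have htr : (fun x z => ∃ y, r x y ∧ r y z) ≤ r := by
      refine hmax (y := fun x z => ∃ y, r x y ∧ r y z) ⟨comp_inv hr hr, fun x => ⟨x, hre x, hre x⟩, ?_, ?_, ?_⟩ ?_
      · rintro x z ⟨y, h1, h2⟩
        exact ⟨y, hsy _ _ h2, hsy _ _ h1⟩
      · obtain ⟨x, y, hxy, h⟩ := hnd
        exact ⟨x, y, hxy, y, h, hre y⟩
      · obtain ⟨x, z, h⟩ := hfull
        refine ⟨x, z, ?_⟩
        rintro ⟨y, h1, h2⟩
        exact h y h1 h2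
      · intro x y h
        exact ⟨y, h, hre y⟩
    refine noBinary hN _ hr.inv (Or.inr (Or.inr ⟨hre, hsy, ?_, ?_, ?_⟩))
    · intro a b c h1 h2
      exact htr a c ⟨b, h1, h2⟩
    · intro he
      obtain ⟨x, y, hxy, h⟩ := hnd
      have : (![x, y] : Fin 2 → A) ∈ {v : Fin 2 → A | r (v 0) (v 1)} := h
      rw [he] at this
      exact hxy this
    · intro he
      obtain ⟨x, y, h⟩ := hnf
      have : (![x, y] : Fin 2 → A) ∈ {v : Fin 2 → A | r (v 0) (v 1)} := by rw [he]; trivial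
      exact h this

theorem refl_case [Fintype A] (hA : 2 ≤ Fintype.card A) (hN : NoList F) (r0 : A → A → Prop)
    (h0 : Inv2 F r0) (hrefl : ∀ x, r0 x x)
    (hnd : ∃ x y, x ≠ y ∧ r0 x y) : ∀ x y, r0 x y := by
  by_contra hnf
  push Not at hnf
  have : Nonempty A := ⟨hnf.choose⟩
  let C : Set (A → A → Prop) := {r | Inv2 F r ∧ (∀ x, r x x) ∧
    (∃ x y, x ≠ y ∧ r x y) ∧ ∃ x y, ¬ r x y}
  obtain ⟨r, hrC, hmax⟩ := Set.Finite.exists_maximal (Set.toFinite C)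
    ⟨r0, h0, hrefl, hnd, hnf⟩
  obtain ⟨hr, hre, ⟨x0, y0, hne0, hr0⟩, hnf⟩ := hrC
  have hanti : ∀ x y, r x y → r y x → x = y := by
    by_contra hcon
    push Not at hcon
    obtain ⟨x, y, h1, h2, hne⟩ := hcon
    have := symm_case hA hN (fun x y => r x y ∧ r y x)
      (fun n f hf x y h => ⟨hr n f hf _ _ (fun i => (h i).1), hr n f hf _ _ (fun i => (h i).2)⟩)
      (fun x => ⟨hre x, hre x⟩) (fun x y h => ⟨h.2, h.1⟩) ⟨x, y, hne, h1, h2⟩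
    obtain ⟨a, b, hab⟩ := hnf
    exact hab (this a b).1
  obtain ⟨o, ho⟩ := common1 hN (fun x y => r y x) (swap_inv hr)
    (symm_case hA hN (fun x z => ∃ y, r x y ∧ r z y) (comp_inv hr (swap_inv hr))
      (fun x => ⟨x, hre x, hre x⟩) (fun x z ⟨y, h1, h2⟩ => ⟨y, h2, h1⟩)
      ⟨x0, y0, hne0, y0, hr0, hre y0⟩)
  obtain ⟨b, hb⟩ := common1 hN r hr
    (symm_case hA hN (fun x z => ∃ y, r y x ∧ r y z) (comp_inv (swap_inv hr) hr)
      (fun x => ⟨x, hre x, hre x⟩) (fun x z ⟨y, h1, h2⟩ => ⟨y, h2, h1⟩)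
      ⟨x0, y0, hne0, x0, hre x0, hr0⟩)
  by_cases hfull : ∀ x z, ∃ y, r x y ∧ r y z
  · obtain ⟨c, h1, h2⟩ := hfull o b
    have hc : c = o := hanti _ _ (ho c) h1
    have hob : o = b := hanti _ _ (hc ▸ h2) (hb o)
    have hx : ∀ x, x = o := fun x => hanti _ _ (ho x) (hob ▸ hb x)
    exact hne0 ((hx x0).trans (hx y0).symm)
  · push Not at hfull
    have htr : (fun x z => ∃ y, r x y ∧ r y z) ≤ r := by
      refine hmax (y := fun x z => ∃ y, r x y ∧ r y z) ⟨comp_inv hr hr, fun x => ⟨x, hre x, hre x⟩, ⟨x0, y0, hne0, y0, hr0, hre y0⟩, ?_⟩ ?_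
      · obtain ⟨x, z, h⟩ := hfull
        refine ⟨x, z, ?_⟩
        rintro ⟨y, h1, h2⟩
        exact h y h1 h2
      · intro x y h
        exact ⟨y, h, hre y⟩
    exact noBinary hN _ hr.inv (Or.inl ⟨hre, hanti, fun a b c h1 h2 => htr a c ⟨b, h1, h2⟩,
      ⟨b, hb⟩, ⟨o, ho⟩⟩)

theorem no_fpf_perm [Fintype A] [Nonempty A] (hN : NoList F) (π : Equiv.Perm A)
    (hπ : Inv2 F (fun x y => y = π x)) (hfix : ∀ a, π a ≠ a) : False := by
  have hpow : ∀ m : ℕ, Inv2 F (fun x y => y = (π ^ m) x) := by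
    intro m
    induction m with
    | zero =>
      intro n f hf x y h
      have : y = x := funext h
      simp [this]
    | succ m ih =>
      have := comp_inv hπ ih
      intro n f hf x y h
      obtain ⟨z, h1, h2⟩ := this n f hf x y (fun i => ⟨_, rfl, by
        rw [h i, pow_succ]; rfl⟩)
      rw [h2, h1, pow_succ]; rfl
  have hfp : ∀ m : ℕ, (∃ a, (π ^ m) a = a) → π ^ m = 1 := by
    intro m hm
    have := unary_full hN (fun a => (π ^ m) a = a) (fun n f hf x hx =>
      (hpow m n f hf x x (fun i => (hx i).symm)).symm) hm
    ext a
    exact this a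
  have hne1 : π ≠ 1 := by
    rintro rfl
    exact hfix (Classical.arbitrary A) rfl
  have hord : orderOf π ≠ 1 := fun h => hne1 (orderOf_eq_one_iff.1 h)
  have hpos : 0 < orderOf π := orderOf_pos π
  have hp := Nat.minFac_prime hord
  have hdvd := Nat.minFac_dvd (orderOf π)
  obtain ⟨d, hd⟩ := hdvd
  have hdpos : 0 < d := by
    rcases Nat.eq_zero_or_pos d with h | h
    · rw [h] at hd; omega
    · exact h
  refine noBinary hN _ (hpow d).inv (Or.inr (Or.inl
    ⟨π ^ d, (orderOf π).minFac, hp, ?_, ?_, rfl⟩))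
  · rw [← pow_mul, mul_comm, ← hd, pow_orderOf_eq_one]
  · intro a ha
    have h1 := hfp d ⟨a, ha⟩
    have h2 := Nat.le_of_dvd hdpos (orderOf_dvd_of_pow_eq_one h1)
    have h3 := hp.two_le
    have : 2 * d ≤ (orderOf π).minFac * d := Nat.mul_le_mul_right d h3
    omega

/-- Binary invariant relations are trivial. -/
theorem B2 [Fintype A] (hA : 2 ≤ Fintype.card A) (hN : NoList F) (r : A → A → Prop)
    (hr : Inv2 F r) (hne : ∃ x y, r x y) : (∀ x y, r x y ↔ x = y) ∨ ∀ x y, r x y := by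
  obtain ⟨a0, b0, hab0⟩ := hne
  have : Nonempty A := ⟨a0⟩
  have hdich : ∀ s : A → A → Prop, Inv2 F s → (∀ x, s x x) →
      (∀ x y, s x y ↔ x = y) ∨ ∀ x y, s x y := by
    intro s hs hsr
    by_cases hd : ∃ x y, x ≠ y ∧ s x y
    · exact Or.inr (refl_case hA hN s hs hsr hd)
    · push Not at hd
      refine Or.inl (fun x y => ⟨fun h => ?_, fun h => h ▸ hsr x⟩)
      by_contra hne
      exact hd x y hne h
  by_cases hdiag : ∃ x, r x x
  · exact hdich r hr (unary_full hN (fun x => r x x) (fun n f hf x hx => hr n f hf x x hx) hdiag)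
  · exfalso
    push Not at hdiag
    have hdom : ∀ x, ∃ y, r x y := unary_full hN _ (fun n f hf x hx => by
      choose y hy using hx
      exact ⟨f y, hr n f hf _ _ hy⟩) ⟨a0, b0, hab0⟩
    have hrng : ∀ y, ∃ x, r x y := unary_full hN _ (fun n f hf x hx => by
      choose y hy using hx
      exact ⟨f y, hr n f hf _ _ hy⟩) ⟨b0, a0, hab0⟩
    have hinj : ∀ x x' y, r x y → r x' y → x = x' := by
      rcases hdich _ (comp_inv hr (swap_inv hr)) (fun x => by
        obtain ⟨y, hy⟩ := hdom x; exact ⟨y, hy, hy⟩) with h | h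
      · exact fun x x' y h1 h2 => (h x x').1 ⟨y, h1, h2⟩
      · obtain ⟨u, hu⟩ := common1 hN (fun x y => r y x) (swap_inv hr) h
        exact absurd (hu u) (hdiag u)
    have hfun : ∀ x y y', r x y → r x y' → y = y' := by
      rcases hdich _ (comp_inv (swap_inv hr) hr) (fun x => by
        obtain ⟨y, hy⟩ := hrng x; exact ⟨y, hy, hy⟩) with h | h
      · exact fun x y y' h1 h2 => (h y y').1 ⟨x, h1, h2⟩
      · obtain ⟨u, hu⟩ := common1 hN r hr h
        exact absurd (hu u) (hdiag u)
    choose g hg using hdom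
    have hgi : Injective g := fun x x' h => hinj x x' (g x) (hg x) (h ▸ hg x')
    let π : Equiv.Perm A := Equiv.ofBijective g (Finite.injective_iff_bijective.1 hgi)
    have hiff : ∀ x y, y = π x ↔ r x y := fun x y =>
      ⟨fun h => h ▸ hg x, fun h => hfun x y _ h (hg x)⟩
    refine no_fpf_perm hN π ?_ ?_
    · intro n f hf x y h
      rw [hiff]
      exact hr n f hf x y (fun i => (hiff _ _).1 (h i))
    · intro a ha
      exact hdiag a ((hiff a a).1 ha.symm)

end binary

section algebra

variable {A : Type*} {F : ∀ n, Set (Op A n)}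

def Un (F : ∀ n, Set (Op A n)) (u : A → A) : Prop := Clo F (I := Unit) (fun v => u (v ()))

def Comm2 (F : ∀ n, Set (Op A n)) (m : A → A → A) : Prop :=
  ∀ n, ∀ f ∈ F n, ∀ x y : Fin n → A, m (f x) (f y) = f (fun i => m (x i) (y i))

def Comm3 (F : ∀ n, Set (Op A n)) (T : A → A → A → A) : Prop :=
  ∀ n, ∀ f ∈ F n, ∀ x y z : Fin n → A,
    T (f x) (f y) (f z) = f (fun i => T (x i) (y i) (z i))

theorem Un.pres2 {u : A → A} (hu : Un F u) {s : A → A → Prop} (hs : Inv2 F s) {x y : A}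
    (h : s x y) : s (u x) (u y) := Clo.pres2 hu hs (fun _ => x) (fun _ => y) (fun _ => h)

theorem Un.pres3 {u : A → A} (hu : Un F u) {s : A → A → A → Prop} (hs : Inv3 F s) {x y z : A}
    (h : s x y z) : s (u x) (u y) (u z) :=
  Clo.pres3 hu hs (fun _ => x) (fun _ => y) (fun _ => z) (fun _ => h)

theorem Un.pres4 {u : A → A} (hu : Un F u) {s : A → A → A → A → Prop} (hs : Inv4 F s)
    {x y z w : A} (h : s x y z w) : s (u x) (u y) (u z) (u w) :=
  Clo.pres4 hu hs (fun _ => x) (fun _ => y) (fun _ => z) (fun _ => w) (fun _ => h)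

theorem Un.pres {V : Type*} {u : A → A} (hu : Un F u) {ρ : Set (V → A)} (hρ : Inv F ρ) {x : V → A}
    (h : x ∈ ρ) : (fun v => u (x v)) ∈ ρ :=
  Clo.pres hu hρ (fun _ => x) (fun _ => h)

theorem Un.id' : Un F (fun x => x) := Clo.proj ()

theorem Un.app {n : ℕ} {f : Op A n} (hf : f ∈ F n) {u : Fin n → A → A} (hu : ∀ i, Un F (u i)) :
    Un F (fun x => f (fun i => u i x)) :=
  Clo.app n f hf (fun i v => u i (v ())) hu

theorem lemU [Fintype A] (hA : 2 ≤ Fintype.card A) (hN : NoList F) {a b : A} (hab : a ≠ b)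
    (c d : A) : ∃ u, Un F u ∧ u a = c ∧ u b = d := by
  rcases B2 hA hN (fun c d => ∃ u, Un F u ∧ u a = c ∧ u b = d) (by
    intro n f hf x y h
    choose u hu h1 h2 using h
    exact ⟨_, Un.app hf hu, by simp only [h1], by simp only [h2]⟩)
    ⟨a, b, _, Un.id', rfl, rfl⟩ with h | h
  · exact absurd ((h a b).1 ⟨_, Un.id', rfl, rfl⟩) hab
  · exact h c d

def tIter (T : A → A → A → A) : ℕ → A → A → A
  | 0, _, y => y
  | n + 1, x, y => T x y (tIter T n x y)

theorem tIter_comm {T : A → A → A → A} (hT : Comm3 F T) (k : ℕ) : Comm2 F (tIter T k) := by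
  induction k with
  | zero => intro n f hf x y; rfl
  | succ k ih =>
    intro n f hf x y
    simp only [tIter]
    rw [ih n f hf, hT n f hf]

theorem aff_false [Fintype A] (hA : 2 ≤ Fintype.card A) (hN : NoList F) (T : A → A → A → A)
    (hT : Comm3 F T) (h1 : ∀ x y, T x x y = y) (h2 : ∀ x y, T y x x = y)
    (hsym : ∀ x y z, T x y z = T z y x)
    (hass : ∀ x y z u v, T (T x y z) u v = T x y (T z u v)) : False := by
  have : Nonempty A := Fintype.card_pos_iff.1 (by omega)
  let o : A := Classical.arbitrary A
  let add : A → A → A := fun x y => T x o y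
  let neg : A → A := fun x => T o x o
  have acomm : ∀ a b, add a b = add b a := fun a b => hsym a o b
  have aassoc : ∀ a b c, add (add a b) c = add a (add b c) := fun a b c => hass a o b o c
  have azero : ∀ a, add a o = a := fun a => h2 o a
  have aneg : ∀ a, add a (neg a) = o := by
    intro a
    change T a o (T o a o) = o
    rw [← hass, h2, h1]
  have hk1 : ∀ a b c, add c (T a c b) = add a b := by
    intro a b c
    change T c o (T a c b) = T a o b
    rw [hsym a c b, ← hass, hsym c o b, hass, h1, hsym]
  have hcancel : ∀ c x, T o c (T c o x) = x := by
    intro c x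
    rw [← hass, h2, h1]
  have hk2 : ∀ a b c d, add a b = add c d ↔ T a c b = d := by
    intro a b c d
    constructor
    · intro h
      have h3 : add c (T a c b) = add c d := (hk1 a b c).trans h
      have h4 := congrArg (T o c) h3
      rwa [hcancel, hcancel] at h4
    · intro h
      rw [← h, hk1]
  let iA : Add A := ⟨add⟩
  let iZ : Zero A := ⟨o⟩
  let iN : Neg A := ⟨neg⟩
  let grp : AddCommGroup A :=
    { AddGroup.ofLeftAxioms (G := A) aassoc (fun a => (acomm _ _).trans (azero a))
        (fun a => (acomm _ _).trans (aneg a)) with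
      add_comm := acomm }
  have hiter : ∀ (n : ℕ) (a : A), iterAdd add o n a = n • a := by
    intro n a
    induction n with
    | zero => rw [zero_smul]; rfl
    | succ n ih => rw [succ_nsmul', ← ih]; rfl
  have hiter2 : ∀ (n : ℕ) (a : A), iterAdd add o n a = tIter T n a o := by
    intro n a
    induction n with
    | zero => rfl
    | succ n ih =>
      change T a o (iterAdd add o n a) = T a o (tIter T n a o)
      rw [ih]
  have hc1 : Fintype.card A ≠ 1 := by omega
  have hp := Nat.minFac_prime hc1
  have : Fact (Fintype.card A).minFac.Prime := ⟨hp⟩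
  obtain ⟨x0, hx0⟩ := exists_prime_addOrderOf_dvd_card (G := A) (Fintype.card A).minFac
    (Nat.minFac_dvd _)
  have hx0ne : x0 ≠ o := by
    intro h
    have h5 : addOrderOf x0 = 1 := by
      rw [AddMonoid.addOrderOf_eq_one_iff]; exact h
    rw [h5] at hx0
    exact hp.one_lt.ne hx0
  have hx0p : tIter T (Fintype.card A).minFac x0 o = o := by
    rw [← hiter2, hiter, ← hx0]
    exact addOrderOf_nsmul_eq_zero x0
  have hr : Inv2 F (fun x y => tIter T (Fintype.card A).minFac x y = y) := by
    intro n f hf x y h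
    rw [tIter_comm hT _ n f hf]
    congr 1
    funext i
    exact h i
  have hall : ∀ x, tIter T (Fintype.card A).minFac x o = o := by
    rcases B2 hA hN _ hr ⟨x0, o, hx0p⟩ with h | h
    · exact absurd ((h x0 o).1 hx0p) hx0ne
    · exact fun x => h x o
  refine noAffine hN {v | add (v 0) (v 1) = add (v 2) (v 3)} ?_
    ⟨add, o, _, hp, acomm, aassoc, azero, fun a => ⟨neg a, aneg a⟩, fun a => ?_, rfl⟩
  · intro n f hf r hr
    change add _ _ = add _ _
    rw [hk2, hT n f hf]
    congr 1
    funext i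
    exact (hk2 _ _ _ _).1 (hr i)
  · rw [hiter2]; exact hall a

theorem lemQ3 [Fintype A] (hA : 2 ≤ Fintype.card A) (hN : NoList F) (s : A → A → A → Prop)
    (hs : Inv3 F s) (htot : ∀ x y, ∃ z, s x y z) (hid : ∀ x z, s x x z → z = x) :
    (∀ c d, s c d c ∧ s c d d) ∨ (∀ x y z z', s x y z → s x y z' → z = z') := by
  have : Nonempty A := Fintype.card_pos_iff.1 (by omega)
  rcases B2 hA hN (fun z z' => ∃ x y, s x y z ∧ s x y z') (by
    intro n f hf z z' h
    choose x y h1 h2 using h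
    exact ⟨f x, f y, hs n f hf _ _ _ h1, hs n f hf _ _ _ h2⟩)
    (by
      let o : A := Classical.arbitrary A
      obtain ⟨z, hz⟩ := htot o o
      exact ⟨z, z, o, o, hz, hz⟩) with h | h
  · right
    intro x y z z' h1 h2
    exact (h z z').1 ⟨x, y, h1, h2⟩
  · left
    obtain ⟨a, b, hab⟩ := common2 hN s hs h
    have hne : a ≠ b := by
      rintro rfl
      obtain ⟨x, y, hxy⟩ := Fintype.exists_pair_of_one_lt_card (α := A) (by omega)
      exact hxy ((hid a x (hab x)).trans (hid a y (hab y)).symm)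
    intro c d
    obtain ⟨u, hu, rfl, rfl⟩ := lemU hA hN hne c d
    exact ⟨hu.pres3 hs (hab a), hu.pres3 hs (hab b)⟩

theorem quasi [Fintype A] (hA : 2 ≤ Fintype.card A) (hN : NoList F) (m : A → A → A)
    (hm : Comm2 F m) (hid : ∀ x, m x x = x) (hn1 : ¬ ∀ x y, m x y = x)
    (hn2 : ¬ ∀ x y, m x y = y) :
    ∃ T : A → A → A → A, Comm3 F T ∧ (∀ x y, T x x y = y) ∧ (∀ x y, T y x x = y) := by
  have : Nonempty A := Fintype.card_pos_iff.1 (by omega)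
  let o : A := Classical.arbitrary A
  have ne1 : ∀ a b, m a b = a → a = b := by
    rcases B2 hA hN (fun a b => m a b = a) (by
      intro n f hf x y h
      rw [hm n f hf]; congr 1; funext i; exact h i) ⟨o, o, hid o⟩ with h | h
    · exact fun a b => (h a b).1
    · exact absurd h hn1
  have ne2 : ∀ a b, m a b = b → a = b := by
    rcases B2 hA hN (fun a b => m a b = b) (by
      intro n f hf x y h
      rw [hm n f hf]; congr 1; funext i; exact h i) ⟨o, o, hid o⟩ with h | h
    · exact fun a b => (h a b).1
    · exact absurd h hn2
  have exne : ∀ y : A, ∃ x, x ≠ y := by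
    intro y
    have : Nontrivial A := Fintype.one_lt_card_iff_nontrivial.1 (by omega)
    exact exists_ne y
  have rinj : ∀ y, Injective (fun x => m x y) := by
    rcases B2 hA hN (fun x x' => ∃ y c, m x y = c ∧ m x' y = c) (by
      intro n f hf x x' h
      choose y c h1 h2 using h
      refine ⟨f y, f c, ?_, ?_⟩ <;> rw [hm n f hf] <;> congr 1 <;> funext i
      · exact h1 i
      · exact h2 i) ⟨o, o, o, _, rfl, rfl⟩ with h | h
    · exact fun y x x' hxx => (h x x').1 ⟨y, _, rfl, hxx.symm⟩
    · obtain ⟨y, c, hyc⟩ := common2 hN (fun y c x => m x y = c) (by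
        intro n f hf y c x h
        rw [hm n f hf]; congr 1; funext i; exact h i) h
      have hc : y = c := (hid y).symm.trans (hyc y)
      subst hc
      obtain ⟨x, hx⟩ := exne y
      exact absurd (ne2 x y (hyc x)) hx
  have linj : ∀ y, Injective (fun x => m y x) := by
    rcases B2 hA hN (fun x x' => ∃ y c, m y x = c ∧ m y x' = c) (by
      intro n f hf x x' h
      choose y c h1 h2 using h
      refine ⟨f y, f c, ?_, ?_⟩ <;> rw [hm n f hf] <;> congr 1 <;> funext i
      · exact h1 i
      · exact h2 i) ⟨o, o, o, _, rfl, rfl⟩ with h | h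
    · exact fun y x x' hxx => (h x x').1 ⟨y, _, rfl, hxx.symm⟩
    · obtain ⟨y, c, hyc⟩ := common2 hN (fun y c x => m y x = c) (by
        intro n f hf y c x h
        rw [hm n f hf]; congr 1; funext i; exact h i) h
      have hc : y = c := (hid y).symm.trans (hyc y)
      subst hc
      obtain ⟨x, hx⟩ := exne y
      exact absurd (ne1 y x (hyc x)) hx.symm
  choose rd hrd using fun z y => Finite.injective_iff_surjective.1 (rinj y) z
  choose ld hld using fun x z => Finite.injective_iff_surjective.1 (linj x) z
  beta_reduce at hrd hld
  have crd : Comm2 F rd := by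
    intro n f hf x y
    apply rinj (f y)
    beta_reduce
    rw [hrd, hm n f hf]
    simp only [hrd]
  have cld : Comm2 F ld := by
    intro n f hf x y
    apply linj (f x)
    beta_reduce
    rw [hld, hm n f hf]
    simp only [hld]
  refine ⟨fun x y z => m (rd x y) (ld y z), ?_, ?_, ?_⟩
  · intro n f hf x y z
    beta_reduce
    rw [crd n f hf, cld n f hf, hm n f hf]
  · intro x y
    have : rd x x = x := rinj x (by beta_reduce; rw [hrd, hid])
    beta_reduce
    rw [this, hld]
  · intro x y
    have : ld x x = x := linj x (by beta_reduce; rw [hld, hid])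
    beta_reduce
    rw [this, hrd]

theorem Comm3.clo {I : Type*} {T : A → A → A → A} (hT : Comm3 F T) {g : (I → A) → A}
    (hg : Clo F g) (x y z : I → A) : T (g x) (g y) (g z) = g (fun i => T (x i) (y i) (z i)) := by
  induction hg with
  | proj i => rfl
  | app n f hf g hg ih => rw [hT n f hf]; simp only [ih]

end algebra

section caseNotG

variable {A : Type*} {F : ∀ n, Set (Op A n)}

/-- there is a binary term behaving like a join on `{o, e}` with respect to bottom `o` -/
def HasG (F : ∀ n, Set (Op A n)) (o e : A) : Prop :=
  ∃ G : (Fin 2 → A) → A, Clo F G ∧ G ![o, o] = o ∧ G ![e, o] = e ∧ G ![o, e] = e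

theorem Un.clo {I : Type*} {u : A → A} (hu : Un F u) {g : (I → A) → A} (hg : Clo F g) :
    Clo F (fun v => u (g v)) :=
  Clo.comp (J := Unit) hu (fun _ => g) (fun _ => hg)

theorem rect [Fintype A] (hA : 2 ≤ Fintype.card A) (hN : NoList F) {o e : A} (hoe : o ≠ e)
    (hG : ¬ HasG F o e) {I : Type*} {G : (I → A) → A} (hGc : Clo F G) (α γ δ : I → A)
    (hα : ∀ i, γ i = α i ∨ δ i = α i) (h : G γ = G δ) : G α = G γ := by
  classical
  by_contra hne
  apply hG
  choose u hu hu0 hu1 using fun i => lemU hA hN hoe (α i) (if γ i = α i then δ i else γ i)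
  obtain ⟨w, hw, hw0, hw1⟩ := lemU hA hN hne o e
  refine ⟨fun x => w (G (fun i => u i (x (if γ i = α i then 1 else 0)))),
    hw.clo (hGc.comp _ (fun i => (hu i).clo (Clo.proj _))), ?_, ?_, ?_⟩
  · have : (fun i => u i ((![o, o] : Fin 2 → A) (if γ i = α i then 1 else 0))) = α := by
      funext i
      by_cases hi : γ i = α i <;> simp [hi, hu0]
    beta_reduce
    rw [this, hw0]
  · have : (fun i => u i ((![e, o] : Fin 2 → A) (if γ i = α i then 1 else 0))) = γ := by
      funext i
      by_cases hi : γ i = α i <;> simp [hi, hu0, hu1]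
    beta_reduce
    rw [this, hw1]
  · have : (fun i => u i ((![o, e] : Fin 2 → A) (if γ i = α i then 1 else 0))) = δ := by
      funext i
      by_cases hi : γ i = α i
      · simp [hi, hu1]
      · simp [hi, hu0, (hα i).resolve_left hi]
    beta_reduce
    rw [this, ← h, hw1]

def sRel (F : ∀ n, Set (Op A n)) (o e : A) (x1 x2 x3 x4 : A) : Prop :=
  ∃ G : (Fin 3 → A) → A, Clo F G ∧ G ![o, o, o] = x1 ∧ G ![o, e, e] = x2 ∧
    G ![e, o, e] = x3 ∧ G ![e, e, o] = x4

theorem sRel_inv (o e : A) : Inv4 F (sRel F o e) := by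
  intro n f hf x y z w h
  choose G hG h1 h2 h3 h4 using h
  exact ⟨_, Clo.app n f hf G hG, by simp only [h1], by simp only [h2], by simp only [h3],
    by simp only [h4]⟩

theorem sRel_sym2 {o e x1 x2 x3 x4 : A} (h : sRel F o e x1 x2 x3 x4) :
    sRel F o e x1 x3 x2 x4 := by
  obtain ⟨G, hG, h1, h2, h3, h4⟩ := h
  have key : ∀ a b c : A, (fun i => (![a, b, c] : Fin 3 → A) ((![1, 0, 2] : Fin 3 → Fin 3) i)) =
      ![b, a, c] := by
    intro a b c; funext i; fin_cases i <;> rfl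
  refine ⟨fun v => G (fun i => v ((![1, 0, 2] : Fin 3 → Fin 3) i)),
    hG.comp _ (fun i => Clo.proj _), ?_, ?_, ?_, ?_⟩ <;> simp only [key] <;> assumption

theorem sRel_sym3 {o e x1 x2 x3 x4 : A} (h : sRel F o e x1 x2 x3 x4) :
    sRel F o e x1 x4 x3 x2 := by
  obtain ⟨G, hG, h1, h2, h3, h4⟩ := h
  have key : ∀ a b c : A, (fun i => (![a, b, c] : Fin 3 → A) ((![2, 1, 0] : Fin 3 → Fin 3) i)) =
      ![c, b, a] := by
    intro a b c; funext i; fin_cases i <;> rfl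
  refine ⟨fun v => G (fun i => v ((![2, 1, 0] : Fin 3 → Fin 3) i)),
    hG.comp _ (fun i => Clo.proj _), ?_, ?_, ?_, ?_⟩ <;> simp only [key] <;> assumption

theorem sRel_sym1 [Fintype A] (hA : 2 ≤ Fintype.card A) (hN : NoList F) {o e x1 x2 x3 x4 : A}
    (hoe : o ≠ e) (h : sRel F o e x1 x2 x3 x4) :
    sRel F o e x2 x1 x4 x3 := by
  obtain ⟨G, hG, h1, h2, h3, h4⟩ := h
  obtain ⟨t, ht, hto, hte⟩ := lemU hA hN hoe e o
  let k : Fin 3 → (Fin 3 → A) → A := ![fun v => v 0, fun v => t (v 1), fun v => t (v 2)]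
  have hk : ∀ i, Clo F (k i) := by
    intro i
    fin_cases i
    · exact Clo.proj 0
    · exact ht.clo (Clo.proj 1)
    · exact ht.clo (Clo.proj 2)
  have key : ∀ a b c : A, (fun i => k i ![a, b, c]) = ![a, t b, t c] := by
    intro a b c; funext i; fin_cases i <;> rfl
  refine ⟨fun v => G (fun i => k i v), hG.comp k hk, ?_, ?_, ?_, ?_⟩ <;>
    simp only [key, hto, hte] <;> assumption

section star

variable [Fintype A]

theorem star_aux (hA : 2 ≤ Fintype.card A) (hN : NoList F) {o e : A} (hoe : o ≠ e)
    (hG : ¬ HasG F o e) {G : (Fin 3 → A) → A} (hGc : Clo F G)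
    (h : G ![o, o, o] = G ![o, e, e]) :
    G ![o, e, o] = G ![o, o, o] ∧ G ![o, o, e] = G ![o, o, o] ∧
    (G ![e, o, e] = G ![o, o, o] ↔ G ![e, e, o] = G ![o, o, o]) := by
  have R := fun α γ δ => rect hA hN hoe hG hGc α γ δ
  have h1 : G ![o, e, o] = G ![o, o, o] :=
    R _ ![o, o, o] ![o, e, e] (by intro i; fin_cases i <;> simp) h
  have h2 : G ![o, o, e] = G ![o, o, o] :=
    R _ ![o, o, o] ![o, e, e] (by intro i; fin_cases i <;> simp) h
  refine ⟨h1, h2, ?_, ?_⟩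
  · intro h3
    have h4 : G ![e, o, o] = G ![o, o, o] :=
      R _ ![o, o, o] ![e, o, e] (by intro i; fin_cases i <;> simp) h3.symm
    have h5 : G ![e, e, o] = G ![o, e, o] :=
      R _ ![o, e, o] ![e, o, o] (by intro i; fin_cases i <;> simp) (h1.trans h4.symm)
    exact h5.trans h1
  · intro h3
    have h4 : G ![e, o, o] = G ![o, o, o] :=
      R _ ![o, o, o] ![e, e, o] (by intro i; fin_cases i <;> simp) h3.symm
    have h5 : G ![e, o, e] = G ![o, o, e] :=
      R _ ![o, o, e] ![e, o, o] (by intro i; fin_cases i <;> simp) (h2.trans h4.symm)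
    exact h5.trans h2

theorem star (hA : 2 ≤ Fintype.card A) (hN : NoList F) {o e : A} (hoe : o ≠ e)
    (hG : ¬ HasG F o e) {x1 x2 x3 x4 : A} (hs : sRel F o e x1 x2 x3 x4) (h12 : x1 = x2) :
    x3 = x4 := by
  obtain ⟨G, hGc, h1, h2, h3, h4⟩ := hs
  obtain ⟨k1, k2, k3⟩ := star_aux hA hN hoe hG hGc (by rw [h1, h2, h12])
  by_contra hqr
  have hpq : x1 ≠ x3 := by
    intro hpq
    have := k3.1 (by rw [h3, h1, hpq])
    exact hqr (by rw [← h4, this, h1, hpq])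
  let s3 : A → A → A → Prop := fun x y z => ∃ w, Un F w ∧ w x1 = x ∧ w x3 = y ∧ w x4 = z
  have hs3 : Inv3 F s3 := by
    intro n f hf x y z h
    choose u hu h1 h2 h3 using h
    exact ⟨_, Un.app hf hu, by simp only [h1], by simp only [h2], by simp only [h3]⟩
  have hw : ∀ w, Un F w → (w x3 = w x1 ↔ w x4 = w x1) := by
    intro w hw
    obtain ⟨-, -, k⟩ := star_aux hA hN hoe hG (hw.clo hGc) (by rw [h1, h2, h12])
    rwa [h1, h3, h4] at k
  have htot : ∀ x y, ∃ z, s3 x y z := by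
    intro x y
    obtain ⟨u, hu, ha, hb⟩ := lemU hA hN hpq x y
    exact ⟨_, u, hu, ha, hb, rfl⟩
  have hid : ∀ x z, s3 x x z → z = x := by
    rintro x z ⟨w, hwu, ha, hb, hc⟩
    rw [← hc, (hw w hwu).1 (by rw [ha, hb]), ha]
  rcases lemQ3 hA hN s3 hs3 htot hid with h | h
  · obtain ⟨⟨w, hwu, ha, hb, hc⟩, -⟩ := h x1 x3
    have := (hw w hwu).2 (by rw [ha, hc])
    rw [ha, hb] at this
    exact hpq this.symm
  · choose m hm using htot
    have hmc : Comm2 F m := fun n f hf x y =>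
      h _ _ _ _ (hm _ _) (hs3 n f hf _ _ _ (fun i => hm (x i) (y i)))
    have hm1 : m x1 x3 = x4 := h _ _ _ _ (hm _ _) ⟨_, Un.id', rfl, rfl, rfl⟩
    have hpr : x1 ≠ x4 := by
      intro hpr
      have := k3.2 (by rw [h4, h1, hpr])
      exact hpq (by rw [← h3, this, h1])
    obtain ⟨T, hT, hT1, hT2⟩ := quasi hA hN m hmc (fun x => hid x _ (hm x x))
      (fun hp => hpr ((hp x1 x3).symm.trans hm1)) (fun hp => hqr ((hp x1 x3).symm.trans hm1))
    have e1 : T (G ![e, o, o]) (G ![o, o, o]) (G ![o, o, e]) = G ![e, o, e] := by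
      rw [hT.clo hGc]; congr 1; funext i; fin_cases i <;> simp [hT1, hT2]
    have e2 : T (G ![e, o, o]) (G ![o, o, o]) (G ![o, e, o]) = G ![e, e, o] := by
      rw [hT.clo hGc]; congr 1; funext i; fin_cases i <;> simp [hT1, hT2]
    rw [k2, hT2] at e1
    rw [k1, hT2] at e2
    exact hqr (by rw [← h3, ← h4, ← e1, ← e2])

theorem hasG (hA : 2 ≤ Fintype.card A) (hN : NoList F) {o e : A} (hoe : o ≠ e) : HasG F o e := by
  by_contra hG
  have : Nonempty A := ⟨o⟩
  have st : ∀ {x1 x2 x3 x4 : A}, sRel F o e x1 x2 x3 x4 → x1 = x2 → x3 = x4 :=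
    fun hs h => star hA hN hoe hG hs h
  have hfun : ∀ a b c y y', sRel F o e a b c y → sRel F o e a b c y' → y = y' := by
    rcases B2 hA hN (fun y y' => ∃ a b c, sRel F o e a b c y ∧ sRel F o e a b c y') (by
      intro n f hf y y' h
      choose a b c h1 h2 using h
      exact ⟨f a, f b, f c, sRel_inv o e n f hf _ _ _ _ h1, sRel_inv o e n f hf _ _ _ _ h2⟩)
      ⟨o, o, o, e, e, ⟨fun v => v 2, Clo.proj 2, rfl, rfl, rfl, rfl⟩,
        ⟨fun v => v 2, Clo.proj 2, rfl, rfl, rfl, rfl⟩⟩ with h | h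
    · exact fun a b c y y' h1 h2 => (h y y').1 ⟨a, b, c, h1, h2⟩
    · exfalso
      obtain ⟨a, b, c, habc⟩ := common3 hN _ (sRel_inv o e) h
      have e1 : c = b := st (sRel_sym3 (habc a)) rfl
      have e2 : a = c :=
        st (sRel_sym2 (sRel_sym1 hA hN hoe (sRel_sym2 (sRel_sym2 (habc b))))) rfl
      have e3 : a = b := e2.trans e1
      exact hoe ((st (habc o) e3).symm.trans (st (habc e) e3))
  have c1 : ∀ c d, sRel F o e c c d d := by
    intro c d
    obtain ⟨u, hu, h1, h2⟩ := lemU hA hN hoe c d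
    exact ⟨fun v => u (v 0), hu.clo (Clo.proj 0), h1, h1, h2, h2⟩
  have c2 : ∀ c d, sRel F o e c d c d := by
    intro c d
    obtain ⟨u, hu, h1, h2⟩ := lemU hA hN hoe c d
    exact ⟨fun v => u (v 1), hu.clo (Clo.proj 1), h1, h2, h1, h2⟩
  have c3 : ∀ c d, sRel F o e c d d c := by
    intro c d
    obtain ⟨u, hu, h1, h2⟩ := lemU hA hN hoe c d
    exact ⟨fun v => u (v 2), hu.clo (Clo.proj 2), h1, h2, h2, h1⟩
  have htot : ∀ a b c, ∃ w, sRel F o e a b c w := by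
    intro a b c
    refine fullAt hN 3 le_rfl {v | ∃ w, sRel F o e (v 0) (v 1) (v 2) w} ?_ ?_ ![a, b, c]
    · intro n f hf r hr
      choose w hw using hr
      exact ⟨f w, sRel_inv o e n f hf _ _ _ _ hw⟩
    · intro v hv
      have : v 0 = v 1 ∨ v 0 = v 2 ∨ v 1 = v 2 := by
        by_contra hcon
        push Not at hcon
        obtain ⟨h01, h02, h12⟩ := hcon
        apply hv
        intro i j hij
        fin_cases i <;> fin_cases j <;> simp_all
      rcases this with h | h | h
      · exact ⟨v 2, by rw [h]; exact c1 _ _⟩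
      · exact ⟨v 1, by rw [← h]; exact c2 _ _⟩
      · exact ⟨v 0, by rw [h]; exact c3 _ _⟩
  choose T hTs using htot
  have hT : Comm3 F T := fun n f hf x y z =>
    hfun _ _ _ _ _ (hTs _ _ _) (sRel_inv o e n f hf _ _ _ _ (fun i => hTs (x i) (y i) (z i)))
  have t1 : ∀ c d, T c c d = d := fun c d => hfun _ _ _ _ _ (hTs _ _ _) (c1 c d)
  have t2 : ∀ c d, T c d c = d := fun c d => hfun _ _ _ _ _ (hTs _ _ _) (c2 c d)
  have t3 : ∀ c d, T c d d = c := fun c d => hfun _ _ _ _ _ (hTs _ _ _) (c3 c d)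
  refine aff_false hA hN T hT t1 (fun x y => t3 y x) ?_ ?_
  · intro x y z
    refine D2 hN {v : Fin 3 → A | T (v 0) (v 1) (v 2) = T (v 2) (v 1) (v 0)} ?_ ?_ ![x, y, z]
    · intro n f hf r hr
      simp only [Set.mem_ofPred_eq, hT n f hf]
      congr 1; funext i; exact hr i
    · intro v c d hv
      simp only [Set.mem_ofPred_eq]
      rcases hv 0 with h0 | h0 <;> rcases hv 1 with h1 | h1 <;> rcases hv 2 with h2 | h2 <;>
        simp [h0, h1, h2, t1, t2, t3]
  · intro x y z u v
    refine D2 hN {v : Fin 5 → A | T (T (v 0) (v 1) (v 2)) (v 3) (v 4) =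
      T (v 0) (v 1) (T (v 2) (v 3) (v 4))} ?_ ?_ ![x, y, z, u, v]
    · intro n f hf r hr
      simp only [Set.mem_ofPred_eq, hT n f hf]
      congr 1; funext i; exact hr i
    · intro v c d hv
      simp only [Set.mem_ofPred_eq]
      rcases hv 0 with h0 | h0 <;> rcases hv 1 with h1 | h1 <;> rcases hv 2 with h2 | h2 <;>
        rcases hv 3 with h3 | h3 <;> rcases hv 4 with h4 | h4 <;>
        simp [h0, h1, h2, h3, h4, t1, t2, t3]

end star

end caseNotG

section caseG

variable {A : Type*} {F : ∀ n, Set (Op A n)} [Fintype A]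

theorem clo2_pres {V : Type*} {G : (Fin 2 → A) → A} (hG : Clo F G) {ρ : Set (V → A)}
    (hρ : Inv F ρ) {x y : V → A} (hx : x ∈ ρ) (hy : y ∈ ρ) :
    (fun v => G ![x v, y v]) ∈ ρ := by
  have := hG.pres hρ ![x, y] (by intro i; fin_cases i <;> assumption)
  convert this using 3 with v
  funext i
  fin_cases i <;> rfl

theorem lemE (hA : 2 ≤ Fintype.card A) (hN : NoList F) {V : Type*} [Fintype V] [DecidableEq V]
    [Nonempty V] (ρ : Set (V → A)) (hρ : Inv F ρ)
    (h : ∀ (a b : A) (v : V), update (fun _ => a) v b ∈ ρ) (x : V → A) : x ∈ ρ := by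
  classical
  obtain ⟨o, e, hoe⟩ := Fintype.exists_pair_of_one_lt_card (α := A) (by omega)
  have : Nonempty A := ⟨o⟩
  obtain ⟨G, hG, g0, g1, g2⟩ := hasG hA hN hoe
  have ind : ∀ S : Finset V, (fun v => if v ∈ S then e else o) ∈ ρ := by
    intro S
    induction S using Finset.induction_on with
    | empty =>
      have := h o o (Classical.arbitrary V)
      rw [update_eq_self_iff.2 rfl] at this
      simpa using this
    | insert v S hv ih =>
      have := clo2_pres hG hρ ih (h o e v)
      convert this using 1
      funext w
      by_cases hw : w = v
      · subst hw; simp [hv, g2]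
      · by_cases hwS : w ∈ S <;> simp [hw, hwS, g0, g1]
  refine D2 hN ρ hρ ?_ x
  intro y c d hy
  obtain ⟨u, hu, h1, h2⟩ := lemU hA hN hoe c d
  have := hu.pres hρ (ind (Finset.univ.filter (fun v => y v = d)))
  convert this using 1
  funext v
  by_cases hv : y v = d
  · simp [hv, h2]
  · have hm : v ∉ Finset.univ.filter (fun v => y v = d) := by simp [hv]
    rw [if_neg hm, h1]; exact ((hy v).resolve_right hv)

theorem malcev_false (hA : 2 ≤ Fintype.card A) (hN : NoList F) (T : A → A → A → A)
    (hT : Comm3 F T) (h1 : ∀ x y, T x x y = y) (h2 : ∀ x y, T y x x = y) : False := by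
  refine aff_false hA hN T hT h1 h2 ?_ ?_
  · intro x y z
    refine lemE hA hN {v : Fin 3 → A | T (v 0) (v 1) (v 2) = T (v 2) (v 1) (v 0)} ?_ ?_ ![x, y, z]
    · intro n f hf r hr
      simp only [Set.mem_ofPred_eq, hT n f hf]
      congr 1; funext i; exact hr i
    · intro a b v
      simp only [Set.mem_ofPred_eq]
      fin_cases v <;> simp [update, h1, h2]
  · intro x y z u v
    refine lemE hA hN {v : Fin 5 → A | T (T (v 0) (v 1) (v 2)) (v 3) (v 4) =
      T (v 0) (v 1) (T (v 2) (v 3) (v 4))} ?_ ?_ ![x, y, z, u, v]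
    · intro n f hf r hr
      simp only [Set.mem_ofPred_eq, hT n f hf]
      congr 1; funext i; exact hr i
    · intro a b v
      simp only [Set.mem_ofPred_eq]
      fin_cases v <;> simp [update, h1, h2]

theorem idem_proj (hA : 2 ≤ Fintype.card A) (hN : NoList F) (m : A → A → A) (hm : Comm2 F m)
    (hid : ∀ x, m x x = x) : (∀ x y, m x y = x) ∨ (∀ x y, m x y = y) := by
  by_contra hcon
  rw [not_or] at hcon
  obtain ⟨T, hT, h1, h2⟩ := quasi hA hN m hm hid hcon.1 hcon.2
  exact malcev_false hA hN T hT h1 h2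

theorem ternary (hA : 2 ≤ Fintype.card A) (hN : NoList F) (s : A → A → A → Prop)
    (hs : Inv3 F s) (htot : ∀ x y, ∃ z, s x y z) (hid : ∀ x z, s x x z → z = x) :
    (∀ x y z, s x y z → z = x) ∨ (∀ x y z, s x y z → z = y) := by
  obtain ⟨o, e, hoe⟩ := Fintype.exists_pair_of_one_lt_card (α := A) (by omega)
  rcases lemQ3 hA hN s hs htot hid with h | h
  · exfalso
    obtain ⟨G, hG, g0, g1, g2⟩ := hasG hA hN hoe
    have := hG.pres3 hs ![o, e] ![e, o] ![o, o] (by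
      intro i
      fin_cases i
      · exact (h o e).1
      · exact (h e o).2)
    rw [g0, g1, g2] at this
    exact hoe (hid _ _ this)
  · choose m hm using htot
    have hmc : Comm2 F m := fun n f hf x y =>
      h _ _ _ _ (hm _ _) (hs n f hf _ _ _ (fun i => hm (x i) (y i)))
    rcases idem_proj hA hN m hmc (fun x => hid x _ (hm x x)) with hp | hp
    · exact Or.inl (fun x y z hz => (h _ _ _ _ hz (hm x y)).trans (hp x y))
    · exact Or.inr (fun x y z hz => (h _ _ _ _ hz (hm x y)).trans (hp x y))

theorem func4 (hA : 2 ≤ Fintype.card A) (hN : NoList F) (s : A → A → A → A → Prop)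
    (hs : Inv4 F s) (h0 : ∀ x z w, s x x z w → z = w) (htot : ∀ x y z, ∃ w, s x y z w) :
    ∀ x y z w w', s x y z w → s x y z w' → w = w' := by
  obtain ⟨o, e, hoe⟩ := Fintype.exists_pair_of_one_lt_card (α := A) (by omega)
  have : Nonempty A := ⟨o⟩
  rcases B2 hA hN (fun w w' => ∃ x y z, s x y z w ∧ s x y z w') (by
    intro n f hf w w' h
    choose x y z h1 h2 using h
    exact ⟨f x, f y, f z, hs n f hf _ _ _ _ h1, hs n f hf _ _ _ _ h2⟩)
    (by
      obtain ⟨w, hw⟩ := htot o o o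
      exact ⟨w, w, o, o, o, hw, hw⟩) with h | h
  · exact fun x y z w w' h1 h2 => (h w w').1 ⟨x, y, z, h1, h2⟩
  · exfalso
    obtain ⟨x1, x2, x3, hx⟩ := common3 hN s hs h
    have hne : x1 ≠ x2 := by
      rintro rfl
      exact hoe ((h0 _ _ _ (hx o)).symm.trans (h0 _ _ _ (hx e)))
    obtain ⟨G, hG, g0, g1, g2⟩ := hasG hA hN hoe
    obtain ⟨u, hu, u1, u2⟩ := lemU hA hN hne o e
    obtain ⟨v, hv, v1, v2⟩ := lemU hA hN hne e o
    have key : ∀ y y', G ![u x3, v x3] = G ![u y, v y'] := by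
      intro y y'
      have := hG.pres4 hs ![u x1, v x1] ![u x2, v x2] ![u x3, v x3] ![u y, v y'] (by
        intro i
        fin_cases i
        · exact hu.pres4 hs (hx y)
        · exact hv.pres4 hs (hx y'))
      rw [u1, v1, u2, v2, g1, g2] at this
      exact h0 _ _ _ this
    have := (key x1 x2).symm.trans (key x1 x1)
    rw [u1, v1, v2, g0, g2] at this
    exact hoe this

theorem ninj3 {v : Fin 3 → A} (hv : ¬ Injective v) : v 0 = v 1 ∨ v 0 = v 2 ∨ v 1 = v 2 := by
  by_contra hcon
  push Not at hcon
  obtain ⟨h01, h02, h12⟩ := hcon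
  apply hv
  intro i j hij
  fin_cases i <;> fin_cases j <;> simp_all

theorem quaternary (hA : 2 ≤ Fintype.card A) (hN : NoList F) (s : A → A → A → A → Prop)
    (hs : Inv4 F s) (h0 : ∀ x z w, s x x z w → z = w) (htot : ∀ x y z, ∃ w, s x y z w)
    (htot' : ∀ x y w, ∃ z, s x y z w) : ∀ x y z w, s x y z w → z = w := by
  obtain ⟨o, e, hoe⟩ := Fintype.exists_pair_of_one_lt_card (α := A) (by omega)
  have hf4 := func4 hA hN s hs h0 htot
  have hf3 := func4 hA hN (fun x y w z => s x y z w)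
    (fun n f hf x y w z h => hs n f hf x y z w h) (fun x w z h => (h0 x z w h).symm) htot'
  choose T hTs using htot
  have hT : Comm3 F T := fun n f hf x y z =>
    hf4 _ _ _ _ _ (hTs _ _ _) (hs n f hf _ _ _ _ (fun i => hTs (x i) (y i) (z i)))
  have t1 : ∀ x z, T x x z = z := fun x z => (h0 x z _ (hTs x x z)).symm
  have t2 : ∀ x y, T x y y = y := by
    rcases idem_proj hA hN (fun x y => T x y y) (fun n f hf x y => hT n f hf x y y)
      (fun x => t1 x x) with hp | hp
    · exact (malcev_false hA hN T hT t1 (fun x y => hp y x)).elim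
    · exact hp
  have t3 : ∀ x y, T x y x = x := by
    rcases idem_proj hA hN (fun x y => T x y x) (fun n f hf x y => hT n f hf x y x)
      (fun x => t1 x x) with hp | hp
    · exact hp
    · exfalso
      have h1 := hTs o e o
      have h2 := hTs o e e
      have h3 : T o e o = e := hp o e
      rw [h3] at h1
      rw [t2] at h2
      exact hoe (hf3 _ _ _ _ _ h1 h2)
  have hall : ∀ x y z, T x y z = z := by
    intro x y z
    refine fullAt hN 3 le_rfl {v | T (v 0) (v 1) (v 2) = v 2} ?_ ?_ ![x, y, z]
    · intro n f hf r hr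
      simp only [Set.mem_ofPred_eq, hT n f hf]
      congr 1; funext i; exact hr i
    · intro v hv
      simp only [Set.mem_ofPred_eq]
      rcases ninj3 hv with h | h | h
      · rw [h, t1]
      · rw [h, t3]
      · rw [h, t2]
  intro x y z w h
  rw [hf4 _ _ _ _ _ h (hTs x y z), hall]

theorem sep_full (hA : 2 ≤ Fintype.card A) (hN : NoList F) : ∀ (n : ℕ) (V : Type) [Fintype V],
    Fintype.card V = n → ∀ ρ : Set (V → A), Inv F ρ → ρ.Nonempty →
      (∀ i j, i ≠ j → ∃ x ∈ ρ, x i ≠ x j) → ∀ v, v ∈ ρ := by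
  classical
  intro n
  induction n with
  | zero =>
    intro V _ hV ρ _ hne _ v
    have := Fintype.card_eq_zero_iff.1 hV
    obtain ⟨x, hx⟩ := hne
    rwa [Subsingleton.elim v x]
  | succ n ih =>
    intro V _ hV ρ hρ hne hsep
    by_cases hn1 : n = 0
    · subst hn1
      obtain ⟨i, hi⟩ := Fintype.card_eq_one_iff.1 hV
      intro v
      obtain ⟨x, hx⟩ := hne
      obtain ⟨y, hy, hyi⟩ := unary_full hN (fun a => ∃ x ∈ ρ, x i = a) (by
        intro n f hf a ha
        choose x hx hxi using ha
        exact ⟨_, hρ n f hf x hx, by simp only [hxi]⟩) ⟨_, x, hx, rfl⟩ (v i)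
      have : v = y := by
        funext j; rw [hi j, hyi]
      rwa [this]
    have hsub : ∀ k : V, Fintype.card {l // l ≠ k} = n := by
      intro k
      have : Fintype.card {l // l ≠ k} = Fintype.card V - 1 := by
        simp [Fintype.card_subtype_compl]
      rw [this, hV]; rfl
    have P1 : ∀ (k : V) (y : V → A), ∃ x ∈ ρ, ∀ l, l ≠ k → x l = y l := by
      intro k y
      have := ih {l // l ≠ k} (hsub k) {w | ∃ x ∈ ρ, ∀ l : {l // l ≠ k}, x l.1 = w l} ?_ ?_ ?_
        (fun l => y l.1)
      · obtain ⟨x, hx, h⟩ := this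
        exact ⟨x, hx, fun l hl => h ⟨l, hl⟩⟩
      · intro n f hf r hr
        choose x hx h using hr
        exact ⟨_, hρ n f hf x hx, fun l => by simp only [h]⟩
      · obtain ⟨x, hx⟩ := hne
        exact ⟨_, x, hx, fun l => rfl⟩
      · intro i j hij
        obtain ⟨x, hx, hxij⟩ := hsep i.1 j.1 (fun h => hij (Subtype.ext h))
        exact ⟨fun l => x l.1, ⟨x, hx, fun l => rfl⟩, hxij⟩
    by_cases hn2 : n = 1
    · subst hn2
      have : 1 < Fintype.card V := by omega
      obtain ⟨i, j, hij⟩ := Fintype.exists_pair_of_one_lt_card this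
      have hall : ∀ l, l = i ∨ l = j := by
        intro l
        have h1 : ({i, j} : Finset V) = Finset.univ := by
          apply Finset.eq_univ_of_card
          rw [Finset.card_pair hij, hV]
        have : l ∈ ({i, j} : Finset V) := by rw [h1]; exact Finset.mem_univ _
        simpa using this
      rcases B2 hA hN (fun a b => ∃ x ∈ ρ, x i = a ∧ x j = b) (by
        intro n f hf a b h
        choose x hx h1 h2 using h
        exact ⟨_, hρ n f hf x hx, by simp only [h1], by simp only [h2]⟩)
        (by obtain ⟨x, hx⟩ := hne; exact ⟨_, _, x, hx, rfl, rfl⟩) with h | h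
      · exfalso
        obtain ⟨x, hx, hxij⟩ := hsep i j hij
        exact hxij ((h _ _).1 ⟨x, hx, rfl, rfl⟩)
      · intro v
        obtain ⟨x, hx, h1, h2⟩ := h (v i) (v j)
        have : v = x := by
          funext l
          rcases hall l with e | e <;> rw [e]
          · exact h1.symm
          · exact h2.symm
        rwa [this]
    by_cases hall : ∀ i j, i ≠ j → ∀ x : V → A, x i = x j → x ∈ ρ
    · refine FullAt.gen (F := F) (fullAt hN _ (by omega)) ρ hρ ?_
      intro v hv
      unfold Injective at hv
      push Not at hv
      obtain ⟨i, j, h1, h2⟩ := hv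
      exact hall i j h2 v h1
    · exfalso
      push Not at hall
      obtain ⟨i, j, hij, x0, hx0, hx0ρ⟩ := hall
      have : ¬ ∀ a b : {l // l ≠ i}, a ≠ b → ∃ x ∈ ρ, x i = x j ∧ x a.1 ≠ x b.1 := by
        intro hs
        have := ih {l // l ≠ i} (hsub i)
          {w | ∃ x ∈ ρ, x i = x j ∧ ∀ l : {l // l ≠ i}, x l.1 = w l} ?_ ?_ ?_ (fun l => x0 l.1)
        · obtain ⟨x, hx, h1, h2⟩ := this
          apply hx0ρ
          have : x0 = x := by
            funext l
            by_cases hl : l = i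
            · rw [hl, hx0, h1]; exact (h2 ⟨j, hij.symm⟩).symm
            · exact (h2 ⟨l, hl⟩).symm
          rwa [this]
        · intro n f hf r hr
          choose x hx h1 h using hr
          exact ⟨_, hρ n f hf x hx, by simp only [h1], fun l => by simp only [h]⟩
        · obtain ⟨k, hk⟩ : ∃ k, k ∉ ({i, j} : Finset V) := by
            by_contra hcon
            push Not at hcon
            have h1 := Finset.eq_univ_of_forall hcon
            have h2 := Finset.card_pair hij
            rw [h1, Finset.card_univ] at h2
            omega
          simp only [Finset.mem_insert, Finset.mem_singleton, not_or] at hk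
          obtain ⟨x, hx, h⟩ := P1 k (fun _ => x0 i)
          exact ⟨_, x, hx, (h i (Ne.symm hk.1)).trans (h j (Ne.symm hk.2)).symm, fun l => rfl⟩
        · intro a b hab
          obtain ⟨x, hx, h1, h2⟩ := hs a b hab
          exact ⟨fun l => x l.1, ⟨x, hx, h1, fun l => rfl⟩, h2⟩
      push Not at this
      obtain ⟨⟨a, hai⟩, ⟨b, hbi⟩, hab, himp⟩ := this
      have hab' : a ≠ b := fun h => hab (Subtype.ext h)
      change ∀ x ∈ ρ, x i = x j → x a = x b at himp
      have tern : ∀ b, b ≠ i → b ≠ j → (∀ x ∈ ρ, x i = x j → x j = x b) → False := by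
        intro b hbi hbj himp
        rcases ternary hA hN (fun x y z => ∃ v ∈ ρ, v i = x ∧ v j = y ∧ v b = z) (by
          intro n f hf x y z h
          choose v hv h1 h2 h3 using h
          exact ⟨_, hρ n f hf v hv, by simp only [h1], by simp only [h2], by simp only [h3]⟩)
          (by
            intro x y
            obtain ⟨v, hv, h⟩ := P1 b (fun l => if l = i then x else y)
            refine ⟨v b, v, hv, ?_, ?_, rfl⟩
            · rw [h i hbi.symm]; simp
            · rw [h j hbj.symm]; simp [hij.symm])
          (by
            rintro x z ⟨v, hv, h1, h2, h3⟩
            rw [← h3, ← himp v hv (h1.trans h2.symm), h2]) with h | h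
        · obtain ⟨v, hv, hne⟩ := hsep b i hbi
          exact hne (h _ _ _ ⟨v, hv, rfl, rfl, rfl⟩)
        · obtain ⟨v, hv, hne⟩ := hsep b j hbj
          exact hne (h _ _ _ ⟨v, hv, rfl, rfl, rfl⟩)
      by_cases haj : a = j
      · subst haj
        exact tern b hbi hab'.symm himp
      by_cases hbj : b = j
      · subst hbj
        exact tern a hai hab' (fun x hx h => (himp x hx h).symm)
      obtain ⟨v, hv, hne⟩ := hsep a b hab'
      refine hne (quaternary hA hN
        (fun x y z w => ∃ v ∈ ρ, v i = x ∧ v j = y ∧ v a = z ∧ v b = w) ?_ ?_ ?_ ?_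
        _ _ _ _ ⟨v, hv, rfl, rfl, rfl, rfl⟩)
      · intro n f hf x y z w h
        choose v hv h1 h2 h3 h4 using h
        exact ⟨_, hρ n f hf v hv, by simp only [h1], by simp only [h2], by simp only [h3],
          by simp only [h4]⟩
      · rintro x z w ⟨v, hv, h1, h2, h3, h4⟩
        rw [← h3, ← h4]
        exact himp v hv (h1.trans h2.symm)
      · intro x y z
        obtain ⟨v, hv, h⟩ := P1 b (fun l => if l = i then x else if l = j then y else z)
        refine ⟨v b, v, hv, ?_, ?_, ?_, rfl⟩
        · rw [h i (Ne.symm hbi)]; simp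
        · rw [h j (Ne.symm hbj)]; simp [hij.symm]
        · rw [h a hab']; simp [hai, haj]
      · intro x y z
        obtain ⟨v, hv, h⟩ := P1 a (fun l => if l = i then x else if l = j then y else z)
        refine ⟨v a, v, hv, ?_, ?_, rfl, ?_⟩
        · rw [h i (Ne.symm hai)]; simp
        · rw [h j (Ne.symm haj)]; simp [hij.symm]
        · rw [h b hab'.symm]; simp [hbi, hbj]

theorem spectrum (hA : 2 ≤ Fintype.card A) (hN : NoList F) (m : ℕ) (B : Set (Fin m → A))
    (hB : B.Nonempty) (hinv : Inv F B) : ∃ k : ℕ, Nat.card B = Fintype.card A ^ k := by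
  classical
  let S : Setoid (Fin m) :=
    { r := fun i j => ∀ x ∈ B, x i = x j
      iseqv := ⟨fun i x _ => rfl, fun h x hx => (h x hx).symm,
        fun h h' x hx => (h x hx).trans (h' x hx)⟩ }
  let Q := Quotient S
  have : Fintype Q := Fintype.ofFinite Q
  let mk : Fin m → Q := fun i => Quotient.mk S i
  have lift : ∀ x ∈ B, ∃ y : Q → A, (fun i => y (mk i)) = x := by
    intro x hx
    exact ⟨Quotient.lift x (fun i j h => h x hx), rfl⟩
  have hfull := sep_full hA hN (Fintype.card Q) Q rfl {y | (fun i => y (mk i)) ∈ B}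
    (fun n f hf r hr => hinv n f hf _ hr)
    (by
      obtain ⟨x, hx⟩ := hB
      obtain ⟨y, hy⟩ := lift x hx
      refine ⟨y, ?_⟩
      change _ ∈ B
      rwa [hy])
    (by
      intro q q' hqq
      induction q using Quotient.inductionOn with
      | h i =>
        induction q' using Quotient.inductionOn with
        | h j =>
          have : ¬ ∀ x ∈ B, x i = x j := fun h => hqq (Quotient.sound h)
          push Not at this
          obtain ⟨x, hx, hne⟩ := this
          obtain ⟨y, hy⟩ := lift x hx
          refine ⟨y, ?_, ?_⟩
          · change _ ∈ B
            rwa [hy]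
          · have h1 : y (mk i) = x i := congrFun hy i
            have h2 : y (mk j) = x j := congrFun hy j
            change y (mk i) ≠ y (mk j)
            rwa [h1, h2])
  refine ⟨Nat.card Q, ?_⟩
  have hbij : Function.Bijective (fun y : Q → A => (⟨fun i => y (mk i), hfull y⟩ : B)) := by
    constructor
    · intro y y' h
      funext q
      induction q using Quotient.inductionOn with
      | h i => exact congrFun (congrArg Subtype.val h) i
    · rintro ⟨x, hx⟩
      obtain ⟨y, hy⟩ := lift x hx
      exact ⟨y, Subtype.ext hy⟩
  rw [← Nat.card_congr (Equiv.ofBijective _ hbij), Nat.card_fun, Nat.card_eq_fintype_card (α := A)]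

end caseG


end Ros

/-- If no relation invariant under `F` belongs to Rosenberg's list, then `(A, F)` has almost
minimal spectrum: every nonempty `F`-invariant subset of `A^m` has cardinality a power of `|A|`. -/
theorem almost_minimal_spectrum {A : Type*} [Fintype A]
    (hA : 2 ≤ Fintype.card A) (F : ∀ n, Set (Op A n))
    (hinv : ∀ ρ : (Σ h : ℕ, Set (Fin h → A)),
      (∀ n, ∀ f ∈ F n, Preserves f ρ.2) → ¬ InRosenbergList ρ) :
    ∀ m : ℕ, 1 ≤ m → ∀ B : Set (Fin m → A), B.Nonempty →
      (∀ n, ∀ f ∈ F n, Preserves f B) →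
      ∃ k : ℕ, Nat.card B = Fintype.card A ^ k := by
  intro m _ B hB hinvB
  exact Ros.spectrum hA hinv m B hB hinvB
end

section
/- Let A be a finite set with |A| ≥ 2 and let ρ ⊆ A × A be a nontrivial equivalence relation on A, i.e., an equivalence relation different from the diagonal {(a,a) : a ∈ A} and from A × A. Then Pol(ρ) is a maximal clone on A. -/
theorem eq_pair {A : Type*} (v : Fin 2 → A) : v = pair (v 0) (v 1) := by
  funext j
  fin_cases j <;> rfl

theorem preserves_iff {A : Type*} {n : ℕ} (f : Op A n) (ρ : Set (Fin 2 → A)) :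
    Preserves f ρ ↔ ∀ a b : Fin n → A, (∀ i, pair (a i) (b i) ∈ ρ) → pair (f a) (f b) ∈ ρ := by
  constructor
  · intro h a b hab
    have := h (fun i => pair (a i) (b i)) hab
    rw [eq_pair (fun j : Fin 2 => f _)] at this
    exact this
  · intro h r hr
    rw [eq_pair (fun j : Fin 2 => f _)]
    apply h
    intro i
    rw [← eq_pair]
    exact hr i

theorem mem_pol_iff {A : Type*} {n : ℕ} (f : Op A n) (ρ : Set (Fin 2 → A)) :
    f ∈ Pol ρ n ↔
      ∀ a b : Fin n → A, (∀ i, pair (a i) (b i) ∈ ρ) → pair (f a) (f b) ∈ ρ :=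
  preserves_iff f ρ

theorem pol_isClone {A : Type*} {h : ℕ} (ρ : Set (Fin h → A)) : IsClone (Pol ρ) := by
  refine ⟨fun n i r hr => hr i, fun n k f g hf hg r hr => ?_⟩
  exact hf (fun i j => g i (fun l => r l j)) (fun i => hg i r hr)

/-- `Pol` of a nontrivial equivalence relation on a finite set with at least two elements
is a maximal clone. -/
theorem nontrivial_equivalence_maximal {A : Type*} [Fintype A]
    (hA : 2 ≤ Fintype.card A) (ρ : Set (Fin 2 → A))
    (hρ : IsNontrivialEquivalence ρ) : IsMaximalClone (Pol ρ) := by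
  classical
  obtain ⟨hrefl, hsymm, htrans, hdiag, huniv⟩ := hρ
  refine ⟨pol_isClone ρ, ?_, ?_⟩
  · intro hall
    obtain ⟨z, o, hzo, hne⟩ : ∃ z o : A, pair z o ∈ ρ ∧ z ≠ o := by
      by_contra hcon
      push Not at hcon
      apply hdiag
      ext v
      constructor
      · intro hv
        rw [eq_pair v] at hv
        exact hcon _ _ hv
      · intro hv
        have hv' : v 0 = v 1 := hv
        rw [eq_pair v, hv']
        exact hrefl _
    apply huniv
    ext v
    simp only [Set.mem_univ, iff_true]
    have hmem : (fun x : Fin 1 → A => if x 0 = z then v 0 else v 1) ∈ Pol ρ 1 := by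
      rw [hall]; trivial
    have := (mem_pol_iff _ ρ).1 hmem (fun _ => z) (fun _ => o) (fun _ => hzo)
    simp only [if_true, if_neg hne.symm] at this
    rw [eq_pair v]
    exact this
  · intro D hD hsub
    by_cases hDP : ∀ n, D n ⊆ Pol ρ n
    · left
      funext n
      exact Set.Subset.antisymm (hDP n) (hsub n)
    right
    push Not at hDP
    obtain ⟨n, hn⟩ := hDP
    obtain ⟨f, hfD, hfP⟩ := Set.not_subset.1 hn
    have hf : ¬ Preserves f ρ := hfP
    rw [preserves_iff] at hf
    push Not at hf
    obtain ⟨a, b, hab, hpq⟩ := hf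
    -- characteristic functions of points
    have hchi : ∀ (k : ℕ) (w : Fin k → A),
        (fun x : Fin k → A => if x = w then f a else f b) ∈ D k := by
      intro k w
      have := hD.2 n k f (fun i x => if x = w then a i else b i) hfD (by
        intro i
        apply hsub
        refine (mem_pol_iff _ ρ).2 ?_
        intro x y _
        split_ifs
        · exact hrefl _
        · exact hab i
        · exact hsymm _ _ (hab i)
        · exact hrefl _)
      convert this using 2 with x
      split_ifs <;> rfl
    funext k
    refine Set.eq_univ_of_forall fun F => ?_
    let e := Fintype.equivFin (Fin k → A)
    let χ : Fin (Fintype.card (Fin k → A)) → Op A k :=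
      fun i x => if x = e.symm i then f a else f b
    let Φ : ((Fin k → A) → Prop) → A := fun P =>
      if h : ∃ x, P x then F h.choose else f a
    let G : Op A (Fintype.card (Fin k → A)) := fun t =>
      Φ (fun x => ∀ i, pair (t i) (χ i x) ∈ ρ)
    have hG : G ∈ D _ := by
      apply hsub
      refine (mem_pol_iff _ ρ).2 ?_
      intro t s hts
      have hP : (fun x => ∀ i, pair (t i) (χ i x) ∈ ρ) = (fun x => ∀ i, pair (s i) (χ i x) ∈ ρ) := by
        funext x
        apply propext
        exact ⟨fun h i => htrans _ _ _ (hsymm _ _ (hts i)) (h i),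
          fun h i => htrans _ _ _ (hts i) (h i)⟩
      have : G t = G s := by
        exact congrArg Φ hP
      rw [this]
      exact hrefl _
    have := hD.2 _ k G χ hG (fun i => hchi k _)
    convert this using 1
    funext x
    have hex : ∃ y, ∀ i, pair (χ i x) (χ i y) ∈ ρ := ⟨x, fun i => hrefl _⟩
    have hval : G (fun i => χ i x) = F hex.choose := dif_pos hex
    rw [hval]
    congr 1
    have hs := hex.choose_spec (e x)
    by_contra hne
    simp only [χ, Equiv.symm_apply_apply, if_true] at hs
    rw [if_neg (fun h => hne h.symm)] at hs
    exact hpq hs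
end
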